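/- arXiv:1903.08021 — 3 statements merged into one kernel-verified Lean document; each statement's English description precedes it below -/
import Mathlib

section
/- Let η be the exponential probability measure e^{-x}1_{x≥0}dx on ℝ and η^n its n-fold product on ℝ^n. Define the cost c(x,y) = Σ_{i=1}^n y_i Λ*_η(x_i/y_i), where Λ*_η(t) = t - 1 - log t for t > 0 and Λ*_η(t) = +∞ for t ≤ 0. Then for every probability measure ν on ℝ^n, the transportation cost W_c(ν, η^n) is at most the relative entropy H(ν | η^n). -/
open MeasureTheory Real Set ENNReal
open scoped Classical

/-- The transportation cost `W_c(ν, μ)`: infimum of `∫ c dπ` over all couplings `π`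
of `ν` and `μ`. -/
noncomputable def transportCost {E F : Type*} [MeasurableSpace E] [MeasurableSpace F]
    (c : E → F → ℝ≥0∞) (ν : Measure E) (μ : Measure F) : ℝ≥0∞ :=
  ⨅ (P : Measure (E × F)) (_ : P.map Prod.fst = ν) (_ : P.map Prod.snd = μ),
    ∫⁻ p, c p.1 p.2 ∂P

/-- The relative entropy `H(ν|μ) = ∫ log (dν/dμ) dν` if `ν ≪ μ` (and the integral is
well defined), and `+∞` otherwise.  (Since the negative part of `log (dν/dμ)` is always
`ν`-integrable for probability measures, non-integrability corresponds to `H = +∞`.) -/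

noncomputable def relEntropy {E : Type*} [MeasurableSpace E] (ν μ : Measure E) : ℝ≥0∞ :=
  if ν ≪ μ ∧ Integrable (fun x => Real.log ((ν.rnDeriv μ x).toReal)) ν
  then ENNReal.ofReal (∫ x, Real.log ((ν.rnDeriv μ x).toReal) ∂ν) else ⊤

/-- The exponential probability measure `e^{-x} 1_{x ≥ 0} dx` on `ℝ`. -/
noncomputable def expMeasure : Measure ℝ :=
  volume.withDensity fun x => ENNReal.ofReal (if 0 ≤ x then Real.exp (-x) else 0)

/-- `Λ*_η(t) = t - 1 - log t` for `t > 0` and `+∞` for `t ≤ 0`. -/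
noncomputable def expRate (t : ℝ) : ℝ≥0∞ :=
  if 0 < t then ENNReal.ofReal (t - 1 - Real.log t) else ⊤

/-- The cost `c(x, y) = ∑ i, y i * Λ*_η (x i / y i)`. -/
noncomputable def expCost (n : ℕ) (x y : Fin n → ℝ) : ℝ≥0∞ :=
  ∑ i, ENNReal.ofReal (y i) * expRate (x i / y i)

open scoped ProbabilityTheory
open Filter Topology

lemma expMeasure_eq_restrict : expMeasure =
    (volume.restrict (Ioi 0)).withDensity fun x => ENNReal.ofReal (Real.exp (-x)) := by
  rw [Measure.restrict_congr_set Ioi_ae_eq_Ici, ← withDensity_indicator measurableSet_Ici,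
    expMeasure]
  congr 1
  ext x
  by_cases hx : 0 ≤ x <;> simp [hx, indicator]

lemma expMeasure_eq_probabilityTheory : expMeasure = ProbabilityTheory.expMeasure 1 := by
  rw [expMeasure, ProbabilityTheory.expMeasure, ProbabilityTheory.gammaMeasure]
  congr 1
  ext x
  have h := ProbabilityTheory.exponentialPDF_eq 1 x
  rw [ProbabilityTheory.exponentialPDF, ProbabilityTheory.exponentialPDFReal] at h
  rw [ProbabilityTheory.gammaPDF, h]
  simp

instance isProbabilityMeasure_expMeasure : IsProbabilityMeasure expMeasure := by
  rw [expMeasure_eq_probabilityTheory]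
  exact ProbabilityTheory.isProbabilityMeasure_expMeasure one_pos

lemma expMeasure_absolutelyContinuous : expMeasure ≪ volume :=
  withDensity_absolutelyContinuous _ _

instance nullSingletonClass_expMeasure : NullSingletonClass expMeasure :=
  ⟨fun _ => expMeasure_absolutelyContinuous (measure_singleton _)⟩

lemma ae_pos_expMeasure : ∀ᵐ x ∂expMeasure, 0 < x := by
  rw [expMeasure_eq_restrict]
  exact (withDensity_absolutelyContinuous _ _).ae_le (ae_restrict_mem measurableSet_Ioi)

lemma expMeasure_Iic (a : ℝ) :
    expMeasure (Iic a) = ENNReal.ofReal (if 0 ≤ a then 1 - Real.exp (-a) else 0) := by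
  have := ProbabilityTheory.isProbabilityMeasure_expMeasure one_pos
  rw [expMeasure_eq_probabilityTheory, ← ProbabilityTheory.ofReal_cdf,
    ProbabilityTheory.cdf_expMeasure_eq one_pos]
  simp

lemma lintegral_expMeasure {h : ℝ → ℝ≥0∞} (hh : Measurable h) :
    ∫⁻ x, h x ∂expMeasure = ∫⁻ x in Ioi 0, ENNReal.ofReal (Real.exp (-x)) * h x := by
  rw [expMeasure_eq_restrict, lintegral_withDensity_eq_lintegral_mul _ (by fun_prop) hh]
  rfl

lemma integrable_expMeasure_iff {h : ℝ → ℝ} :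
    Integrable h expMeasure ↔ IntegrableOn (fun x => Real.exp (-x) * h x) (Ioi 0) := by
  rw [expMeasure_eq_restrict, integrable_withDensity_iff_integrable_smul' (by fun_prop) (by simp),
    IntegrableOn]
  refine integrable_congr (ae_of_all _ fun x => ?_)
  simp [Real.exp_nonneg]

lemma integrable_rpow_mul_exp_expMeasure {s b : ℝ} (hs : -1 < s) (hb : b < 1) :
    Integrable (fun x => x ^ s * Real.exp (b * x)) expMeasure := by
  rw [integrable_expMeasure_iff]
  refine (integrableOn_rpow_mul_exp_neg_mul_rpow hs one_pos (sub_pos.2 hb)).congr_fun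
    (fun x _ => ?_) measurableSet_Ioi
  simp only [Real.rpow_one]
  rw [mul_left_comm, ← Real.exp_add]
  ring_nf

lemma integrable_pow_expMeasure (k : ℕ) : Integrable (fun x => x ^ k) expMeasure := by
  simpa using integrable_rpow_mul_exp_expMeasure (s := k) (b := 0)
    (by linarith [(Nat.cast_nonneg k : (0 : ℝ) ≤ k)]) one_pos

lemma setLIntegral_id_expMeasure {a : ℝ} (ha : 0 ≤ a) :
    ∫⁻ y in Ioi a, ENNReal.ofReal y ∂expMeasure = ENNReal.ofReal ((1 + a) * Real.exp (-a)) := by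
  have hd : ∀ x ∈ Ici a, HasDerivAt (fun x => -((1 + x) * Real.exp (-x))) (x * Real.exp (-x)) x := by
    intro x _
    have h := (((hasDerivAt_id x).const_add 1).mul (hasDerivAt_neg x).exp).neg
    exact h.congr_deriv (by simp only [id]; ring)
  have hnn : ∀ x ∈ Ioi a, 0 ≤ x * Real.exp (-x) := fun x hx =>
    mul_nonneg (ha.trans hx.le) (Real.exp_nonneg _)
  have ht : Tendsto (fun x : ℝ => -((1 + x) * Real.exp (-x))) atTop (𝓝 0) := by
    have h0 := Real.tendsto_pow_mul_exp_neg_atTop_nhds_zero 0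
    have h1 := Real.tendsto_pow_mul_exp_neg_atTop_nhds_zero 1
    have := (h0.add h1).neg
    simp only [add_zero, neg_zero] at this
    refine this.congr fun x => ?_
    ring
  rw [← lintegral_indicator measurableSet_Ioi,
    lintegral_expMeasure ((by fun_prop : Measurable fun y : ℝ => ENNReal.ofReal y).indicator
      measurableSet_Ioi)]
  have : ∀ x, ENNReal.ofReal (Real.exp (-x)) * (Ioi a).indicator (fun y => ENNReal.ofReal y) x =
      (Ioi a).indicator (fun x => ENNReal.ofReal (x * Real.exp (-x))) x := by
    intro x
    by_cases hx : x ∈ Ioi a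
    · simp only [hx, indicator_of_mem]
      rw [mul_comm, ENNReal.ofReal_mul (ha.trans (mem_Ioi.1 hx).le)]
    · simp [hx]
  simp_rw [this]
  rw [lintegral_indicator measurableSet_Ioi, Measure.restrict_restrict measurableSet_Ioi,
    inter_eq_left.2 (Ioi_subset_Ioi ha),
    ← ofReal_integral_eq_lintegral_ofReal
      (integrableOn_Ioi_deriv_of_nonneg' hd hnn ht) (ae_restrict_of_forall_mem measurableSet_Ioi hnn),
    integral_Ioi_of_hasDerivAt_of_nonneg' hd hnn ht]
  simp

lemma integrable_sqrt_abs_log_expMeasure :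
    Integrable (fun x => Real.exp (|Real.log x| / 2)) expMeasure := by
  refine Integrable.mono' ((integrable_rpow_mul_exp_expMeasure (s := 1 / 2) (b := 0)
    (by norm_num) one_pos).add (integrable_rpow_mul_exp_expMeasure (s := - (1 / 2)) (b := 0)
    (by norm_num) one_pos)) (by fun_prop) ?_
  filter_upwards [ae_pos_expMeasure] with x hx
  simp only [Real.norm_eq_abs, Real.abs_exp, Pi.add_apply, zero_mul, Real.exp_zero, mul_one]
  rw [Real.rpow_def_of_pos hx, Real.rpow_def_of_pos hx]
  rcases abs_cases (Real.log x) with ⟨h, _⟩ | ⟨h, _⟩ <;> rw [h]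
  · have := Real.exp_pos (Real.log x * -(1 / 2))
    have h2 : Real.log x / 2 = Real.log x * (1 / 2) := by ring
    rw [h2]; linarith
  · have := Real.exp_pos (Real.log x * (1 / 2))
    have h2 : -Real.log x / 2 = Real.log x * -(1 / 2) := by ring
    rw [h2]; linarith

/-- Functions with an exponential moment are integrable for measures of finite entropy. -/
lemma integrable_of_integrable_exp {E : Type*} [MeasurableSpace E] {μ ν : Measure E}
    [IsFiniteMeasure μ] [IsFiniteMeasure ν] (hac : μ ≪ ν) (hint : Integrable (llr μ ν) μ)
    {v : E → ℝ} (hv : Measurable v) (hv0 : ∀ x, 0 ≤ v x)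
    (hexp : Integrable (fun x => Real.exp (v x)) ν) : Integrable v μ := by
  rw [← integrable_rnDeriv_smul_iff hac]
  have h1 := (integrable_rnDeriv_mul_log_iff hac).2 hint
  refine Integrable.mono' (h1.norm.add hexp)
    (by fun_prop) (ae_of_all _ fun x => ?_)
  set f := (μ.rnDeriv ν x).toReal with hf
  have hf0 : 0 ≤ f := ENNReal.toReal_nonneg
  simp only [smul_eq_mul, Pi.add_apply, Real.norm_eq_abs, ← hf]
  rw [abs_of_nonneg (mul_nonneg hf0 (hv0 x))]
  rcases hf0.eq_or_lt with h0 | h0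
  · rw [← h0]; simp [Real.exp_nonneg]
  have h2 := Real.add_one_le_exp (v x - Real.log f)
  have h3 : Real.exp (v x) = f * Real.exp (v x - Real.log f) := by
    rw [Real.exp_sub, Real.exp_log h0]; field_simp
  have h4 := le_abs_self (f * Real.log f)
  rw [h3]
  nlinarith

/-- The transport map from `μ` to the exponential measure: minus the logarithm of the
survival function. -/
noncomputable def negLogSurvival (μ : Measure ℝ) (x : ℝ) : ℝ := -Real.log (μ.real (Ioi x))

section Survival

variable {μ : Measure ℝ}

lemma antitone_survival [IsFiniteMeasure μ] : Antitone fun x => μ.real (Ioi x) :=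
  fun _ _ h => measureReal_mono (Ioi_subset_Ioi h)

lemma measurable_negLogSurvival [IsFiniteMeasure μ] : Measurable (negLogSurvival μ) :=
  (antitone_survival.measurable.log).neg

lemma negLogSurvival_nonneg [IsProbabilityMeasure μ] (x : ℝ) : 0 ≤ negLogSurvival μ x :=
  neg_nonneg.2 (Real.log_nonpos measureReal_nonneg measureReal_le_one)

lemma continuous_survival [IsFiniteMeasure μ] [NullSingletonClass μ] :
    Continuous fun x => μ.real (Ioi x) := by
  rw [continuous_iff_continuousAt]
  intro t
  have h : (fun x => μ.real (Ioi x)) = fun x => ∫ y, (Ioi x).indicator (fun _ => (1 : ℝ)) y ∂μ := by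
    ext x; rw [integral_indicator_const _ measurableSet_Ioi]; simp
  rw [h]
  refine continuousAt_of_dominated (bound := fun _ => 1) (.of_forall fun x =>
    (measurable_const.indicator measurableSet_Ioi).aestronglyMeasurable)
    (.of_forall fun x => ae_of_all _ fun y => ?_) (integrable_const _) ?_
  · by_cases hy : y ∈ Ioi x <;> simp [hy]
  · have : ∀ᵐ y ∂μ, y ≠ t := by simp [ae_iff]
    filter_upwards [this] with y hy
    rcases lt_or_gt_of_ne hy with hy | hy
    · refine (continuousAt_const (y := (0 : ℝ))).congr ?_
      filter_upwards [lt_mem_nhds hy] with x hx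
      simp [not_lt.2 hx.le]
    · refine (continuousAt_const (y := (1 : ℝ))).congr ?_
      filter_upwards [gt_mem_nhds hy] with x hx
      simp [hx]

lemma tendsto_survival_atTop [IsFiniteMeasure μ] :
    Tendsto (fun x => μ.real (Ioi x)) atTop (𝓝 0) := by
  have h := tendsto_measure_iInter_atTop (μ := μ) (s := fun x : ℝ => Ioi x)
    (fun _ => measurableSet_Ioi.nullMeasurableSet) (fun _ _ h => Ioi_subset_Ioi h)
    ⟨0, measure_ne_top _ _⟩
  have h0 : ⋂ x : ℝ, Ioi x = ∅ := by
    ext y; simpa using ⟨y, le_refl y⟩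
  rw [h0, measure_empty] at h
  exact (ENNReal.tendsto_toReal ENNReal.zero_ne_top).comp h

lemma tendsto_survival_atBot [IsProbabilityMeasure μ] :
    Tendsto (fun x => μ.real (Ioi x)) atBot (𝓝 1) := by
  have h := tendsto_measure_iUnion_atBot (μ := μ) (s := fun x : ℝ => Ioi x)
    (fun _ _ h => Ioi_subset_Ioi h)
  have h0 : ⋃ x : ℝ, Ioi x = univ := by
    ext y; simp
  rw [h0, measure_univ] at h
  exact (ENNReal.tendsto_toReal ENNReal.one_ne_top).comp h

/-- Probability integral transform: the survival function of an atomless probability measure,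
evaluated at a random point of that measure, is uniformly distributed. -/
lemma measureReal_survival_lt [IsProbabilityMeasure μ] [NullSingletonClass μ] {s : ℝ} (hs0 : 0 < s)
    (hs1 : s ≤ 1) : μ.real {x | μ.real (Ioi x) < s} = s := by
  wlog hs1 : s < 1 generalizing s
  · obtain rfl : s = 1 := by linarith
    refine le_antisymm measureReal_le_one (le_of_forall_lt_imp_le_of_dense fun c hc => ?_)
    have h : max c (1 / 2) < 1 := max_lt hc (by norm_num)
    calc c ≤ max c (1 / 2) := le_max_left _ _
      _ = μ.real {x | μ.real (Ioi x) < max c (1 / 2)} := (this (by positivity) h.le h).symm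
      _ ≤ _ := measureReal_mono fun x (hx : μ.real (Ioi x) < max c (1 / 2)) => hx.trans h
  have hcont := continuous_survival (μ := μ)
  set A := {x | s ≤ μ.real (Ioi x)} with hA
  have hAne : A.Nonempty :=
    ((tendsto_survival_atBot (μ := μ)).eventually (lt_mem_nhds hs1)).exists.imp fun _ h => h.le
  obtain ⟨b, hb⟩ := ((tendsto_survival_atTop (μ := μ)).eventually (gt_mem_nhds hs0)).exists
  have hAb : BddAbove A := ⟨b, fun x hx => by
    by_contra! h
    exact absurd (hb.trans_le (le_trans hx (antitone_survival (μ := μ) h.le))) (lt_irrefl _)⟩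
  have hAc : IsClosed A := isClosed_le continuous_const hcont
  set t := sSup A
  have ht : t ∈ A := hAc.csSup_mem hAne hAb
  have hset : {x | μ.real (Ioi x) < s} = Ioi t := by
    ext x
    simp only [mem_ofPred_eq, mem_Ioi]
    constructor
    · intro hx
      by_contra! h
      exact absurd (hx.trans_le (le_trans ht (antitone_survival (μ := μ) h))) (lt_irrefl _)
    · intro hx
      by_contra! h
      exact absurd (le_csSup hAb h) (not_le.2 hx)
  rw [hset]
  refine le_antisymm ?_ ht
  refine le_of_tendsto (hcont.continuousWithinAt (s := Ioi t) (x := t)).tendsto ?_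
  filter_upwards [self_mem_nhdsWithin] with x hx
  have : x ∈ {x | μ.real (Ioi x) < s} := hset ▸ hx
  exact this.le

lemma ae_survival_pos [IsProbabilityMeasure μ] [NullSingletonClass μ] :
    ∀ᵐ x ∂μ, 0 < μ.real (Ioi x) := by
  rw [ae_iff]
  simp only [not_lt]
  rw [← measureReal_eq_zero_iff]
  refine le_antisymm (le_of_forall_pos_le_add fun ε hε => ?_) measureReal_nonneg
  have hpos : 0 < min ε 1 := by positivity
  have := measureReal_survival_lt (μ := μ) hpos (min_le_right _ _)
  calc μ.real {x | μ.real (Ioi x) ≤ 0} ≤ μ.real {x | μ.real (Ioi x) < min ε 1} :=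
        measureReal_mono fun x (hx : μ.real (Ioi x) ≤ 0) => hx.trans_lt hpos
    _ ≤ 0 + ε := by rw [this]; simp

lemma map_negLogSurvival [IsProbabilityMeasure μ] [NullSingletonClass μ] :
    μ.map (negLogSurvival μ) = expMeasure := by
  have hm := measurable_negLogSurvival (μ := μ)
  have := Measure.isProbabilityMeasure_map (μ := μ) hm.aemeasurable
  refine Measure.ext_of_Iic _ _ fun a => ?_
  rw [Measure.map_apply hm measurableSet_Iic, expMeasure_Iic]
  split_ifs with ha
  · set B : Set ℝ := {x | μ.real (Ioi x) < Real.exp (-a)} with hB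
    have hBm : MeasurableSet B := antitone_survival.measurable measurableSet_Iio
    have h1 : negLogSurvival μ ⁻¹' Iic a =ᵐ[μ] (Bᶜ : Set ℝ) := by
      filter_upwards [ae_survival_pos (μ := μ)] with x hx
      apply propext
      change -Real.log (μ.real (Ioi x)) ≤ a ↔ ¬ (μ.real (Ioi x) < Real.exp (-a))
      rw [not_lt, ← Real.le_log_iff_exp_le hx, neg_le]
    rw [measure_congr h1, ← ofReal_measureReal, measureReal_compl hBm, hB,
      measureReal_survival_lt (Real.exp_pos _) (by simpa using ha)]
    simp
  · have : negLogSurvival μ ⁻¹' Iic a = ∅ := by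
      ext x
      simpa using (not_le.1 ha).trans_le (negLogSurvival_nonneg x)
    simp [this]

lemma ae_negLogSurvival_pos [IsProbabilityMeasure μ] [NullSingletonClass μ] :
    ∀ᵐ x ∂μ, 0 < negLogSurvival μ x :=
  ae_of_ae_map measurable_negLogSurvival.aemeasurable
    (by rw [map_negLogSurvival]; exact ae_pos_expMeasure)

lemma Ioi_ae_eq_lt_negLogSurvival [IsProbabilityMeasure μ] [NullSingletonClass μ] {t : ℝ}
    (ht : 0 < μ.real (Ioi t)) :
    Ioi t =ᵐ[μ] {x | negLogSurvival μ t < negLogSurvival μ x} := by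
  have h1 : {x | negLogSurvival μ t < negLogSurvival μ x} =ᵐ[μ]
      {x | μ.real (Ioi x) < μ.real (Ioi t)} := by
    filter_upwards [ae_survival_pos (μ := μ)] with x hx
    apply propext
    change -Real.log (μ.real (Ioi t)) < -Real.log (μ.real (Ioi x)) ↔ μ.real (Ioi x) < μ.real (Ioi t)
    rw [neg_lt_neg_iff, Real.log_lt_log_iff hx ht]
  refine EventuallyEq.trans (EventuallyEq.symm ?_) h1.symm
  refine ae_eq_of_subset_of_measure_ge (fun x hx => ?_) (le_of_eq ?_)
    (antitone_survival.measurable measurableSet_Iio).nullMeasurableSet (measure_ne_top _ _)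
  · by_contra h
    exact absurd (antitone_survival (μ := μ) (not_lt.1 h)) (not_le.2 hx)
  · rw [← ofReal_measureReal (μ := μ) (s := {x | _}), measureReal_survival_lt ht measureReal_le_one,
      ofReal_measureReal]

lemma setLIntegral_negLogSurvival_Ioi [IsProbabilityMeasure μ] [NullSingletonClass μ] (t : ℝ) :
    ∫⁻ x in Ioi t, ENNReal.ofReal (negLogSurvival μ x) ∂μ =
      ENNReal.ofReal (μ.real (Ioi t)) + ENNReal.ofReal (Real.negMulLog (μ.real (Ioi t))) := by
  rcases (measureReal_nonneg (μ := μ) (s := Ioi t)).eq_or_lt with h0 | h0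
  · rw [← h0, Measure.restrict_eq_zero.2 ((measureReal_eq_zero_iff).1 h0.symm)]
    simp
  · have hset : {x | negLogSurvival μ t < negLogSurvival μ x} =
        negLogSurvival μ ⁻¹' Ioi (negLogSurvival μ t) := rfl
    rw [Measure.restrict_congr_set (Ioi_ae_eq_lt_negLogSurvival h0), hset,
      ← setLIntegral_map (μ := μ) (f := fun y => ENNReal.ofReal y) measurableSet_Ioi (by fun_prop)
        measurable_negLogSurvival, map_negLogSurvival,
      setLIntegral_id_expMeasure (negLogSurvival_nonneg t),
      ← ENNReal.ofReal_add h0.le (Real.negMulLog_nonneg h0.le measureReal_le_one)]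
    congr 1
    rw [negLogSurvival, neg_neg, Real.exp_log h0, Real.negMulLog]
    ring

lemma lintegral_negLogSurvival [IsProbabilityMeasure μ] [NullSingletonClass μ] :
    ∫⁻ x, ENNReal.ofReal (negLogSurvival μ x) ∂μ = 1 := by
  rw [← lintegral_map (μ := μ) (f := fun y => ENNReal.ofReal y) (by fun_prop)
    measurable_negLogSurvival, map_negLogSurvival]
  have h := setLIntegral_id_expMeasure le_rfl
  have : ∀ᵐ x ∂expMeasure, x ∈ Ioi (0 : ℝ) := ae_pos_expMeasure
  rw [Measure.restrict_eq_self_of_ae_mem this] at h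
  simpa using h

lemma setLIntegral_negLogSurvival_Iic [IsProbabilityMeasure μ] [NullSingletonClass μ] (t : ℝ) :
    μ (Iic t) = ∫⁻ x in Iic t, ENNReal.ofReal (negLogSurvival μ x) ∂μ +
      ENNReal.ofReal (Real.negMulLog (μ.real (Ioi t))) := by
  have h1 := lintegral_add_compl (μ := μ) (fun x => ENNReal.ofReal (negLogSurvival μ x))
    (measurableSet_Iic (a := t))
  have h2 := prob_add_prob_compl (μ := μ) (measurableSet_Iic (a := t))
  rw [compl_Iic, setLIntegral_negLogSurvival_Ioi, lintegral_negLogSurvival, ← h2, compl_Iic,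
    ofReal_measureReal, add_comm (μ (Ioi t)), ← add_assoc] at h1
  exact ((ENNReal.add_left_inj (measure_ne_top _ _)).1 h1).symm

end Survival

lemma setLIntegral_inv_Ioo {a b : ℝ} (ha : 0 < a) (hab : a ≤ b) :
    ∫⁻ t in Ioo a b, ENNReal.ofReal t⁻¹ = ENNReal.ofReal (Real.log (b / a)) := by
  have hb := ha.trans_le hab
  rw [restrict_Ioo_eq_restrict_Ioc, ← integral_inv_of_pos ha hb, intervalIntegral.integral_of_le hab,
    ofReal_integral_eq_lintegral_ofReal]
  · refine (ContinuousOn.integrableOn_Icc ?_).mono_set Ioc_subset_Icc_self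
    exact continuousOn_inv₀.mono fun t ht => (ha.trans_le ht.1).ne'
  · exact ae_restrict_of_forall_mem measurableSet_Ioc fun x hx => inv_nonneg.2 (ha.trans hx.1).le

lemma lintegral_mul_log {μ : Measure ℝ} [SFinite μ] (hpos : ∀ᵐ x ∂μ, 0 < x) {w : ℝ → ℝ≥0∞}
    (hw : Measurable w) : ∫⁻ x, w x * ENNReal.ofReal (Real.log x) ∂μ =
      ∫⁻ t in Ioi 1, ENNReal.ofReal t⁻¹ * ∫⁻ x in Ioi t, w x ∂μ := by
  have h1 : ∀ᵐ x ∂μ, w x * ENNReal.ofReal (Real.log x) =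
      ∫⁻ t in Ioi 1, w x * (if t < x then ENNReal.ofReal t⁻¹ else 0) := by
    filter_upwards [hpos] with x hx
    rw [lintegral_const_mul _ (Measurable.ite measurableSet_Iio (by fun_prop) (by fun_prop))]
    congr 1
    have : (fun t => if t < x then ENNReal.ofReal t⁻¹ else 0) =
      (Iio x).indicator fun t => ENNReal.ofReal t⁻¹ := by ext t; simp [indicator]
    rw [this, lintegral_indicator measurableSet_Iio, Measure.restrict_restrict measurableSet_Iio,
      inter_comm, Ioi_inter_Iio]
    rcases le_total 1 x with h | h
    · rw [setLIntegral_inv_Ioo one_pos h, div_one]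
    · simp [Ioo_eq_empty (not_lt.2 h), Real.log_nonpos hx.le h]
  rw [lintegral_congr_ae h1, lintegral_lintegral_swap]
  · refine lintegral_congr fun t => ?_
    rw [← lintegral_indicator measurableSet_Ioi, ← lintegral_const_mul _
      (hw.indicator measurableSet_Ioi)]
    refine lintegral_congr fun x => ?_
    by_cases h : t < x <;> simp [h, mul_comm]
  · exact ((hw.comp measurable_fst).mul (Measurable.ite (measurableSet_lt measurable_snd measurable_fst)
      (by fun_prop) measurable_const)).aemeasurable

lemma lintegral_mul_neg_log {μ : Measure ℝ} [SFinite μ] (hpos : ∀ᵐ x ∂μ, 0 < x) {w : ℝ → ℝ≥0∞}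
    (hw : Measurable w) : ∫⁻ x, w x * ENNReal.ofReal (-Real.log x) ∂μ =
      ∫⁻ t in Ioc 0 1, ENNReal.ofReal t⁻¹ * ∫⁻ x in Iic t, w x ∂μ := by
  have h1 : ∀ᵐ x ∂μ, w x * ENNReal.ofReal (-Real.log x) =
      ∫⁻ t in Ioc 0 1, w x * (if x ≤ t then ENNReal.ofReal t⁻¹ else 0) := by
    filter_upwards [hpos] with x hx
    rw [lintegral_const_mul _ (Measurable.ite measurableSet_Ici (by fun_prop) (by fun_prop))]
    congr 1
    have : (fun t => if x ≤ t then ENNReal.ofReal t⁻¹ else 0) =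
      (Ici x).indicator fun t => ENNReal.ofReal t⁻¹ := by ext t; simp [indicator]
    have h2 : Ici x ∩ Ioc 0 1 = Icc x 1 := by
      ext t; simp only [mem_inter_iff, mem_Ici, mem_Ioc, mem_Icc]
      exact ⟨fun h => ⟨h.1, h.2.2⟩, fun h => ⟨h.1, hx.trans_le h.1, h.2⟩⟩
    rw [this, lintegral_indicator measurableSet_Ici, Measure.restrict_restrict measurableSet_Ici,
      h2, ← restrict_Ioo_eq_restrict_Icc]
    rcases le_total x 1 with h | h
    · rw [setLIntegral_inv_Ioo hx h, one_div, Real.log_inv]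
    · simp [Ioo_eq_empty (not_lt.2 h), Real.log_nonneg h]
  rw [lintegral_congr_ae h1, lintegral_lintegral_swap]
  · refine lintegral_congr fun t => ?_
    rw [← lintegral_indicator measurableSet_Iic, ← lintegral_const_mul _
      (hw.indicator measurableSet_Iic)]
    refine lintegral_congr fun x => ?_
    by_cases h : x ≤ t <;> simp [h, mul_comm]
  · exact ((hw.comp measurable_fst).mul (Measurable.ite (measurableSet_le measurable_fst measurable_snd)
      (by fun_prop) measurable_const)).aemeasurable

section Survival

variable {μ : Measure ℝ}

lemma integrable_negLogSurvival_pow [IsProbabilityMeasure μ] [NullSingletonClass μ] (k : ℕ) :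
    Integrable (fun x => negLogSurvival μ x ^ k) μ := by
  have h := integrable_pow_expMeasure k
  rw [← map_negLogSurvival (μ := μ)] at h
  exact h.comp_measurable measurable_negLogSurvival

/-- Integration by parts along the transport map to the exponential measure. -/
lemma integrable_negLogSurvival_mul_log [IsProbabilityMeasure μ] [NullSingletonClass μ]
    (hpos : ∀ᵐ x ∂μ, 0 < x) (hid : Integrable (fun x => x) μ) (hlog : Integrable Real.log μ) :
    Integrable (fun x => negLogSurvival μ x * Real.log x) μ ∧
      0 ≤ ∫ x, (negLogSurvival μ x - 1) * Real.log x ∂μ ∧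
      ∫⁻ t in Ioi 0, ENNReal.ofReal t⁻¹ * ENNReal.ofReal (Real.negMulLog (μ.real (Ioi t))) =
        ENNReal.ofReal (∫ x, (negLogSurvival μ x - 1) * Real.log x ∂μ) := by
  have hS := measurable_negLogSurvival (μ := μ)
  have hSm : Measurable fun x => ENNReal.ofReal (negLogSurvival μ x) := by fun_prop
  set R := fun t => ENNReal.ofReal t⁻¹ * ENNReal.ofReal (Real.negMulLog (μ.real (Ioi t))) with hR
  have hRm : Measurable R := by
    have h1 := Real.continuous_negMulLog.measurable
    have h2 : Measurable fun t => μ.real (Ioi t) := antitone_survival.measurable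
    fun_prop
  have hplus := lintegral_mul_log hpos hSm
  have hplus1 := lintegral_mul_log hpos (measurable_const (a := (1 : ℝ≥0∞)))
  have hminus := lintegral_mul_neg_log hpos hSm
  have hminus1 := lintegral_mul_neg_log hpos (measurable_const (a := (1 : ℝ≥0∞)))
  simp only [one_mul, lintegral_const, Measure.restrict_apply_univ] at hplus1 hminus1
  simp only [setLIntegral_negLogSurvival_Ioi, mul_add] at hplus
  rw [lintegral_add_right _ hRm] at hplus
  have hof : ∀ t, ENNReal.ofReal (μ.real (Ioi t)) = μ (Ioi t) := fun t => ofReal_measureReal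
  simp only [hof] at hplus
  rw [← hplus1] at hplus
  simp only [setLIntegral_negLogSurvival_Iic, mul_add] at hminus1
  rw [lintegral_add_right _ hRm, ← hminus] at hminus1
  have hA := hlog.lintegral_lt_top
  have hA' := hlog.neg.lintegral_lt_top
  have hB : ∫⁻ x, ENNReal.ofReal (negLogSurvival μ x) * ENNReal.ofReal (Real.log x) ∂μ < ∞ := by
    refine lt_of_le_of_lt (lintegral_mono_ae ?_)
      ((integrable_negLogSurvival_pow (μ := μ) 2).add hid).lintegral_lt_top
    filter_upwards [hpos] with x hx
    rw [← ENNReal.ofReal_mul (negLogSurvival_nonneg x)]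
    rcases le_total (Real.log x) 0 with h | h
    · rw [ENNReal.ofReal_of_nonpos (mul_nonpos_of_nonneg_of_nonpos (negLogSurvival_nonneg x) h)]
      exact zero_le
    · apply ENNReal.ofReal_le_ofReal
      have h1 : Real.log x ≤ 2 * √x := by
        have h2 := Real.log_le_self (Real.sqrt_nonneg x)
        rw [Real.log_sqrt hx.le] at h2
        linarith
      have h3 := Real.sq_sqrt hx.le
      simp only [Pi.add_apply]
      nlinarith [sq_nonneg (negLogSurvival μ x - Real.log x / 2),
        Real.sqrt_nonneg x, mul_self_le_mul_self h h1]
  have hB' : ∫⁻ x, ENNReal.ofReal (negLogSurvival μ x) * ENNReal.ofReal (-Real.log x) ∂μ < ∞ :=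
    lt_of_le_of_lt (hminus1 ▸ le_self_add) hA'
  have hint : Integrable (fun x => negLogSurvival μ x * Real.log x) μ := by
    refine ⟨(hS.mul Real.measurable_log).aestronglyMeasurable, ?_⟩
    rw [hasFiniteIntegral_iff_norm]
    refine lt_of_le_of_lt (lintegral_mono fun x => ?_)
      ((lintegral_add_left (hSm.mul (by fun_prop)) _).trans_lt (ENNReal.add_lt_top.2 ⟨hB, hB'⟩))
    simp only [Pi.mul_apply]
    rw [norm_mul, Real.norm_of_nonneg (negLogSurvival_nonneg x),
      ENNReal.ofReal_mul (negLogSurvival_nonneg x), ← mul_add]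
    gcongr
    rw [Real.norm_eq_abs]
    rcases abs_cases (Real.log x) with ⟨h, _⟩ | ⟨h, _⟩ <;> rw [h]
    · exact le_self_add
    · exact le_add_self
  refine ⟨hint, ?_⟩
  have hsplit : ∫⁻ t in Ioi 0, R t = (∫⁻ t in Ioc 0 1, R t) + ∫⁻ t in Ioi 1, R t := by
    rw [← lintegral_union measurableSet_Ioi (Ioc_disjoint_Ioi le_rfl), Ioc_union_Ioi_eq_Ioi zero_le_one]
  have hRp : ∫⁻ t in Ioi 1, R t ≠ ∞ := ((hplus ▸ le_add_self).trans_lt hB).ne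
  have hRn : ∫⁻ t in Ioc 0 1, R t ≠ ∞ := ((hminus1 ▸ le_add_self).trans_lt hA').ne
  have key : ∫ x, (negLogSurvival μ x - 1) * Real.log x ∂μ =
      ((∫⁻ t in Ioc 0 1, R t) + ∫⁻ t in Ioi 1, R t).toReal := by
    simp only [sub_mul, one_mul]
    rw [integral_sub hint hlog, integral_eq_lintegral_pos_part_sub_lintegral_neg_part hint,
      integral_eq_lintegral_pos_part_sub_lintegral_neg_part hlog]
    simp only [← mul_neg, ENNReal.ofReal_mul (negLogSurvival_nonneg _)]
    rw [hplus, hminus1, ENNReal.toReal_add hA.ne hRp, ENNReal.toReal_add hB'.ne hRn,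
      ENNReal.toReal_add hRn hRp]
    ring
  rw [key, hsplit, ENNReal.ofReal_toReal (ENNReal.add_ne_top.2 ⟨hRn, hRp⟩)]
  exact ⟨ENNReal.toReal_nonneg, rfl⟩

lemma negLogSurvival_expMeasure {x : ℝ} (hx : 0 ≤ x) : negLogSurvival expMeasure x = x := by
  rw [negLogSurvival, ← compl_Iic, measureReal_compl measurableSet_Iic,
    measureReal_def expMeasure (Iic x), expMeasure_Iic, if_pos hx, ENNReal.toReal_ofReal (by simpa using hx)]
  simp

lemma integrable_log_of_llr [IsProbabilityMeasure μ] (hac : μ ≪ expMeasure)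
    (hint : Integrable (llr μ expMeasure) μ) : Integrable Real.log μ := by
  have h := integrable_of_integrable_exp hac hint (v := fun x => |Real.log x| / 2) (by fun_prop)
    (fun x => by positivity) integrable_sqrt_abs_log_expMeasure
  refine (h.const_mul 2).mono' (by fun_prop) (ae_of_all _ fun x => ?_)
  rw [Real.norm_eq_abs]; linarith

lemma integrable_id_of_llr [IsProbabilityMeasure μ] (hac : μ ≪ expMeasure)
    (hint : Integrable (llr μ expMeasure) μ) : Integrable (fun x => x) μ := by
  have h := integrable_of_integrable_exp hac hint (v := fun x => |x| / 2) (by fun_prop)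
    (fun x => by positivity) (by
      refine (integrable_rpow_mul_exp_expMeasure (s := 0) (b := 1 / 2) (by norm_num)
        (by norm_num)).congr ?_
      filter_upwards [ae_pos_expMeasure] with x hx
      rw [abs_of_pos hx, Real.rpow_zero, one_mul]
      ring_nf)
  refine (h.const_mul 2).mono' (by fun_prop) (ae_of_all _ fun x => ?_)
  rw [Real.norm_eq_abs]; linarith

lemma expMeasure_log_moments : Integrable Real.log expMeasure ∧
    Integrable (fun x => x * Real.log x) expMeasure ∧
      ∫ x, (x - 1) * Real.log x ∂expMeasure = 1 := by
  have hllr : Integrable (llr expMeasure expMeasure) expMeasure :=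
    (integrable_congr (llr_self expMeasure)).2 (integrable_zero _ _ _)
  have hlog := integrable_log_of_llr .rfl hllr
  obtain ⟨h1, -, h2⟩ := integrable_negLogSurvival_mul_log ae_pos_expMeasure
    (integrable_id_of_llr .rfl hllr) hlog
  have hS : ∀ᵐ x ∂expMeasure, negLogSurvival expMeasure x = x := by
    filter_upwards [ae_pos_expMeasure] with x hx using negLogSurvival_expMeasure hx.le
  refine ⟨hlog, h1.congr (hS.mono fun x hx => by simp only [hx]), ?_⟩
  rw [integral_congr_ae (hS.mono fun x hx => by simp only [hx] : _ =ᵐ[expMeasure]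
    fun x => (x - 1) * Real.log x)] at h2
  have h3 : ∫⁻ t in Ioi 0, ENNReal.ofReal t⁻¹ *
      ENNReal.ofReal (Real.negMulLog (expMeasure.real (Ioi t))) = 1 := by
    have h5 := lintegral_expMeasure (measurable_const (a := (1 : ℝ≥0∞)))
    rw [lintegral_const, measure_univ, one_mul] at h5
    rw [h5]
    refine setLIntegral_congr_fun measurableSet_Ioi fun t (ht : 0 < t) => ?_
    have h4 : expMeasure.real (Ioi t) = Real.exp (-t) := by
      rw [← compl_Iic, measureReal_compl measurableSet_Iic, measureReal_def expMeasure (Iic t),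
        expMeasure_Iic, if_pos ht.le, ENNReal.toReal_ofReal (by simpa using ht.le)]
      simp
    simp only [h4, Real.negMulLog, Real.log_exp, mul_one]
    rw [← ENNReal.ofReal_mul (by positivity)]
    congr 1
    field_simp
  rw [h3] at h2
  simpa using h2.symm

end Survival

/-- The transportation-entropy inequality in dimension one, along the monotone transport map. -/
lemma lintegral_expRate_le_klDiv {μ : Measure ℝ} [IsProbabilityMeasure μ] (hac : μ ≪ expMeasure) :
    ∫⁻ x, ENNReal.ofReal (negLogSurvival μ x) * expRate (x / negLogSurvival μ x) ∂μ ≤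
      InformationTheory.klDiv μ expMeasure := by
  have : NullSingletonClass μ := ⟨fun x => hac (measure_singleton x)⟩
  by_cases hint : Integrable (llr μ expMeasure) μ
  swap
  · simp [InformationTheory.klDiv_of_not_integrable hint]
  have hpos : ∀ᵐ x ∂μ, 0 < x := hac.ae_le ae_pos_expMeasure
  have hSpos := ae_negLogSurvival_pos (μ := μ)
  have hid := integrable_id_of_llr hac hint
  have hlog := integrable_log_of_llr hac hint
  obtain ⟨hSlog, hI0, hI⟩ := integrable_negLogSurvival_mul_log hpos hid hlog
  have hSm := measurable_negLogSurvival (μ := μ)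
  have hSint : Integrable (negLogSurvival μ) μ := by
    simpa using integrable_negLogSurvival_pow (μ := μ) 1
  obtain ⟨e1, e2, e3⟩ := expMeasure_log_moments
  rw [← map_negLogSurvival (μ := μ)] at e1 e2 e3
  have hlogS : Integrable (fun x => Real.log (negLogSurvival μ x)) μ := e1.comp_measurable hSm
  have hSlogS : Integrable (fun x => negLogSurvival μ x * Real.log (negLogSurvival μ x)) μ :=
    e2.comp_measurable hSm
  rw [integral_map hSm.aemeasurable (by fun_prop)] at e3
  set S := negLogSurvival μ with hS
  set f : ℝ → ℝ := fun x => (μ.rnDeriv expMeasure x).toReal with hf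
  set r : ℝ → ℝ := fun x => x⁻¹ * Real.negMulLog (μ.real (Ioi x)) with hr
  have hr0 : ∀ x, 0 < x → 0 ≤ r x := fun x hx => mul_nonneg (inv_nonneg.2 hx.le)
    (Real.negMulLog_nonneg measureReal_nonneg measureReal_le_one)
  set u : ℝ → ℝ := fun x => r x * Real.exp x / f x with hu
  have hfm : Measurable f := by fun_prop
  have hrm : Measurable r := by
    have h1 := Real.continuous_negMulLog.measurable
    have h2 : Measurable fun t => μ.real (Ioi t) := antitone_survival.measurable
    fun_prop
  have hum : Measurable u := by fun_prop
  have hu0 : 0 ≤ᵐ[μ] u := by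
    filter_upwards [hpos] with x hx
    exact div_nonneg (mul_nonneg (hr0 x hx) (Real.exp_nonneg _)) ENNReal.toReal_nonneg
  have hule : ∫⁻ x, ENNReal.ofReal (u x) ∂μ ≤ ENNReal.ofReal (∫ x, (S x - 1) * Real.log x ∂μ) := by
    rw [← hI, ← lintegral_rnDeriv_mul hac (by fun_prop)]
    calc ∫⁻ x, μ.rnDeriv expMeasure x * ENNReal.ofReal (u x) ∂expMeasure
        ≤ ∫⁻ x, ENNReal.ofReal (r x * Real.exp x) ∂expMeasure := by
          refine lintegral_mono_ae ?_
          filter_upwards [ae_pos_expMeasure, μ.rnDeriv_ne_top expMeasure] with x hx hx'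
          rw [← ENNReal.ofReal_toReal hx', ← ENNReal.ofReal_mul ENNReal.toReal_nonneg]
          refine ENNReal.ofReal_le_ofReal ?_
          simp only [hu]
          by_cases h0 : f x = 0
          · rw [h0]
            simpa using mul_nonneg (hr0 x hx) (Real.exp_nonneg x)
          · exact (mul_div_cancel₀ _ h0).le
      _ = _ := by
          rw [lintegral_expMeasure (by fun_prop)]
          refine setLIntegral_congr_fun measurableSet_Ioi fun x (hx : 0 < x) => ?_
          simp only [hr]
          rw [← ENNReal.ofReal_mul (Real.exp_nonneg _), ← ENNReal.ofReal_mul (inv_nonneg.2 hx.le)]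
          congr 1
          rw [mul_comm, mul_assoc, ← Real.exp_add]
          simp
  have huint : Integrable u μ := by
    refine ⟨hum.aestronglyMeasurable, ?_⟩
    rw [hasFiniteIntegral_iff_ofReal hu0]
    exact hule.trans_lt ENNReal.ofReal_lt_top
  have hule' : ∫ x, u x ∂μ ≤ ∫ x, (S x - 1) * Real.log x ∂μ := by
    rw [integral_eq_lintegral_of_nonneg_ae hu0 hum.aestronglyMeasurable]
    exact ENNReal.toReal_le_of_le_ofReal hI0 hule
  have hpt : ∀ᵐ x ∂μ, x - S x + Real.log (S x) - Real.log x + 1 - u x ≤ llr μ expMeasure x := by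
    filter_upwards [hpos, hSpos, ae_survival_pos (μ := μ), Measure.rnDeriv_pos hac,
      hac.ae_le (μ.rnDeriv_ne_top expMeasure)] with x hx hSx hG hfx0 hfx1
    have hfx : 0 < f x := ENNReal.toReal_pos hfx0.ne' hfx1
    have hGS : Real.log (μ.real (Ioi x)) = - S x := by rw [hS, negLogSurvival, neg_neg]
    have hueq : u x = x⁻¹ * (μ.real (Ioi x) * S x) * Real.exp x / f x := by
      simp only [hu, hr, Real.negMulLog, hGS]
      ring
    have hupos : 0 < u x := by rw [hueq]; positivity
    have hlogu : Real.log (u x) = - S x + Real.log (S x) - Real.log x + x - Real.log (f x) := by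
      rw [hueq, Real.log_div (by positivity) hfx.ne', Real.log_mul (by positivity) (by positivity),
        Real.log_mul (by positivity) (by positivity), Real.log_mul hG.ne' hSx.ne', Real.log_inv,
        Real.log_exp, hGS]
      ring
    have := Real.log_le_sub_one_of_pos hupos
    rw [hlogu] at this
    rw [llr]
    linarith
  have hL : Integrable (fun x => x - S x + Real.log (S x) - Real.log x + 1) μ :=
    (((hid.sub hSint).add hlogS).sub hlog).add (integrable_const 1)
  have hH : ∫ x, (x - S x + Real.log (S x) - Real.log x + 1) ∂μ - ∫ x, u x ∂μ ≤
      ∫ x, llr μ expMeasure x ∂μ := by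
    rw [← integral_sub hL huint]
    exact integral_mono_ae (hL.sub huint) hint hpt
  have hcint : Integrable (fun x => x - S x - S x * Real.log x + S x * Real.log (S x)) μ :=
    ((hid.sub hSint).sub hSlog).add hSlogS
  have hcost : ∀ᵐ x ∂μ, ENNReal.ofReal (S x) * expRate (x / S x) =
      ENNReal.ofReal (x - S x - S x * Real.log x + S x * Real.log (S x)) := by
    filter_upwards [hpos, hSpos] with x hx hSx
    rw [expRate, if_pos (div_pos hx hSx), ← ENNReal.ofReal_mul hSx.le,
      Real.log_div hx.ne' hSx.ne']
    congr 1
    field_simp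
    ring
  have hc0 : 0 ≤ᵐ[μ] fun x => x - S x - S x * Real.log x + S x * Real.log (S x) := by
    filter_upwards [hpos, hSpos] with x hx hSx
    have h := mul_nonneg hSx.le (sub_nonneg.2 (Real.log_le_sub_one_of_pos (div_pos hx hSx)))
    rw [Real.log_div hx.ne' hSx.ne'] at h
    have h2 : S x * (x / S x - 1 - (Real.log x - Real.log (S x))) =
      x - S x - S x * Real.log x + S x * Real.log (S x) := by
      field_simp
      ring
    exact h2 ▸ h
  rw [lintegral_congr_ae hcost, ← ofReal_integral_eq_lintegral_ofReal hcint hc0,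
    InformationTheory.klDiv_of_ac_of_integrable hac hint]
  refine ENNReal.ofReal_le_ofReal ?_
  rw [probReal_univ, probReal_univ, add_sub_cancel_right]
  have hsum : ∫ x, (x - S x + Real.log (S x) - Real.log x + 1) ∂μ =
      ∫ x, (x - S x - S x * Real.log x + S x * Real.log (S x)) ∂μ +
        ∫ x, (S x - 1) * Real.log x ∂μ - ∫ x, (S x - 1) * Real.log (S x) ∂μ + 1 := by
    have i1 : Integrable (fun x => (S x - 1) * Real.log x) μ := (hSlog.sub hlog).congr
      (ae_of_all _ fun x => by simp only [Pi.sub_apply]; ring)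
    have i2 : Integrable (fun x => (S x - 1) * Real.log (S x)) μ := (hSlogS.sub hlogS).congr
      (ae_of_all _ fun x => by simp only [Pi.sub_apply]; ring)
    have i3 : Integrable (fun x => x - S x - S x * Real.log x + S x * Real.log (S x) +
      (S x - 1) * Real.log x) μ := hcint.add i1
    have i4 := integral_sub i3 i2
    rw [← integral_add hcint i1, ← i4]
    have i5 := integral_add (i3.sub i2) (integrable_const (1 : ℝ))
    simp only [integral_const, probReal_univ, one_smul, Pi.sub_apply] at i5
    rw [← i5]
    congr 1
    ext x
    ring
  linarith

section ConditionalEntropy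

open ProbabilityTheory

variable {E : Type*} [MeasurableSpace E] {ρ : Measure E} [IsProbabilityMeasure ρ]
  {κ η : Kernel E ℝ} [IsMarkovKernel κ] [IsMarkovKernel η]

lemma rnDeriv_compProd_right (hac : ρ ⊗ₘ κ ≪ ρ ⊗ₘ η) :
    (ρ ⊗ₘ κ).rnDeriv (ρ ⊗ₘ η) =ᵐ[ρ ⊗ₘ η] fun p => κ.rnDeriv η p.1 p.2 := by
  have hκη : ∀ᵐ x ∂ρ, κ x ≪ η x := Measure.absolutelyContinuous_compProd_right_iff.1 hac
  have hm : Measurable fun p : E × ℝ => κ.rnDeriv η p.1 p.2 := Kernel.measurable_rnDeriv κ η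
  have h : ρ ⊗ₘ κ = (ρ ⊗ₘ η).withDensity fun p => κ.rnDeriv η p.1 p.2 := by
    ext s hs
    rw [withDensity_apply _ hs, ← lintegral_indicator hs,
      Measure.lintegral_compProd (hm.indicator hs), Measure.compProd_apply hs]
    refine lintegral_congr_ae ?_
    filter_upwards [hκη] with x hx
    have hsx : MeasurableSet (Prod.mk x ⁻¹' s) := measurable_prodMk_left hs
    rw [← Kernel.setLIntegral_rnDeriv hx hsx, ← lintegral_indicator hsx]
    rfl
  rw [h]
  exact Measure.rnDeriv_withDensity _ hm

lemma lintegral_klDiv_eq_klDiv_compProd (hac : ρ ⊗ₘ κ ≪ ρ ⊗ₘ η) :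
    ∫⁻ x, InformationTheory.klDiv (κ x) (η x) ∂ρ =
      InformationTheory.klDiv (ρ ⊗ₘ κ) (ρ ⊗ₘ η) := by
  have hκη : ∀ᵐ x ∂ρ, κ x ≪ η x := Measure.absolutelyContinuous_compProd_right_iff.1 hac
  have hm : Measurable fun p : E × ℝ => κ.rnDeriv η p.1 p.2 := Kernel.measurable_rnDeriv κ η
  have hk := InformationTheory.measurable_klFun
  have h : ∀ᵐ p ∂(ρ ⊗ₘ η),
      ENNReal.ofReal (InformationTheory.klFun ((ρ ⊗ₘ κ).rnDeriv (ρ ⊗ₘ η) p).toReal) =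
        ENNReal.ofReal (InformationTheory.klFun (κ.rnDeriv η p.1 p.2).toReal) := by
    filter_upwards [rnDeriv_compProd_right hac] with p hp
    rw [hp]
  rw [InformationTheory.klDiv_eq_lintegral_klFun_of_ac hac, lintegral_congr_ae h,
    Measure.lintegral_compProd (by fun_prop)]
  refine lintegral_congr_ae ?_
  filter_upwards [hκη] with x hx
  rw [InformationTheory.klDiv_eq_lintegral_klFun_of_ac hx]
  refine lintegral_congr_ae ?_
  filter_upwards [Kernel.rnDeriv_eq_rnDeriv_measure (κ := κ) (η := η) (a := x)] with y hy
  rw [hy]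

end ConditionalEntropy

lemma measurable_expRate : Measurable expRate :=
  Measurable.ite measurableSet_Ioi (by fun_prop) measurable_const

lemma measurable_expCost (n : ℕ) : Measurable fun p : (Fin n → ℝ) × (Fin n → ℝ) =>
    expCost n p.1 p.2 := by
  have := measurable_expRate
  unfold expCost
  fun_prop

lemma relEntropy_eq_klDiv {E : Type*} [MeasurableSpace E] (ν μ : Measure E)
    [IsProbabilityMeasure ν] [IsProbabilityMeasure μ] :
    relEntropy ν μ = InformationTheory.klDiv ν μ := by
  unfold relEntropy
  split_ifs with h
  · rw [InformationTheory.klDiv_of_ac_of_integrable h.1 h.2, probReal_univ, probReal_univ,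
      add_sub_cancel_right]
    rfl
  · exact (InformationTheory.klDiv_eq_top_iff.2 (not_and.1 h)).symm

section Gluing

open ProbabilityTheory

variable {E F : Type*} [MeasurableSpace E] [MeasurableSpace F]
  {κ : Kernel E ℝ} [IsMarkovKernel κ]

lemma measurable_negLogSurvival_kernel :
    Measurable fun p : E × ℝ => negLogSurvival (κ p.1) p.2 := by
  have hs : MeasurableSet {q : (E × ℝ) × ℝ | q.1.2 < q.2} :=
    measurableSet_lt (by fun_prop) (by fun_prop)
  have h := Kernel.measurable_kernel_prodMk_left (κ := κ.comap Prod.fst measurable_fst) hs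
  exact h.ennreal_toReal.log.neg

/-- Extension of a coupling by the monotone transports of the conditional laws. -/
noncomputable def gluedCoupling (κ : Kernel E ℝ) (P : Measure (E × F)) :
    Measure ((E × ℝ) × (F × ℝ)) :=
  (P ⊗ₘ κ.comap Prod.fst measurable_fst).map
    fun q => ((q.1.1, q.2), (q.1.2, negLogSurvival (κ q.1.1) q.2))

lemma measurable_glue : Measurable fun q : (E × F) × ℝ =>
    ((q.1.1, q.2), (q.1.2, negLogSurvival (κ q.1.1) q.2)) := by
  have h := (measurable_negLogSurvival_kernel (κ := κ)).comp
    (by fun_prop : Measurable fun q : (E × F) × ℝ => (q.1.1, q.2))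
  fun_prop

variable {P : Measure (E × F)} [IsProbabilityMeasure P]

lemma map_fst_gluedCoupling :
    (gluedCoupling κ P).map Prod.fst = P.map Prod.fst ⊗ₘ κ := by
  have : IsProbabilityMeasure (P.map Prod.fst) :=
    Measure.isProbabilityMeasure_map measurable_fst.aemeasurable
  rw [gluedCoupling, Measure.map_map measurable_fst measurable_glue]
  ext s hs
  rw [Measure.map_apply (by fun_prop) hs, Measure.compProd_apply, Measure.compProd_apply hs,
    lintegral_map (Kernel.measurable_kernel_prodMk_left hs) measurable_fst]
  · rfl
  · exact (by fun_prop : Measurable fun q : (E × F) × ℝ => (q.1.1, q.2)) hs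

lemma map_snd_gluedCoupling (hac : ∀ᵐ x ∂P.map Prod.fst, κ x ≪ expMeasure) :
    (gluedCoupling κ P).map Prod.snd = (P.map Prod.snd).prod expMeasure := by
  have : IsProbabilityMeasure (P.map Prod.snd) :=
    Measure.isProbabilityMeasure_map measurable_snd.aemeasurable
  rw [gluedCoupling, Measure.map_map measurable_snd measurable_glue]
  refine (Measure.prod_eq fun s t hs ht => ?_).symm
  have hm := measurable_snd.comp (measurable_glue (κ := κ) (F := F))
  rw [Measure.map_apply hm (hs.prod ht), Measure.compProd_apply (hm (hs.prod ht)),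
    Measure.map_apply measurable_snd hs, mul_comm, ← setLIntegral_const, ← lintegral_indicator]
  · refine lintegral_congr_ae ?_
    filter_upwards [ae_of_ae_map measurable_fst.aemeasurable hac] with p hp
    have : NullSingletonClass (κ p.1) := ⟨fun x => hp (measure_singleton x)⟩
    by_cases h : p.2 ∈ s
    · rw [indicator_of_mem (show p ∈ Prod.snd ⁻¹' s from h), ← map_negLogSurvival (μ := κ p.1),
        Measure.map_apply measurable_negLogSurvival ht, Kernel.comap_apply]
      congr 1
      ext x
      simp [h]
    · rw [indicator_of_notMem (show p ∉ Prod.snd ⁻¹' s from h), Kernel.comap_apply]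
      convert measure_empty (μ := κ p.1)
      ext x
      simp [h]
  · exact measurable_snd hs

lemma lintegral_gluedCoupling {c : E × F → ℝ≥0∞} (hc : Measurable c) {d : ℝ × ℝ → ℝ≥0∞}
    (hd : Measurable d) :
    ∫⁻ q, (d (q.1.2, q.2.2) + c (q.1.1, q.2.1)) ∂gluedCoupling κ P =
      ∫⁻ x, ∫⁻ t, d (t, negLogSurvival (κ x) t) ∂κ x ∂P.map Prod.fst + ∫⁻ p, c p ∂P := by
  have h := (measurable_negLogSurvival_kernel (κ := κ)).comp
    (by fun_prop : Measurable fun q : (E × F) × ℝ => (q.1.1, q.2))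
  have h' := measurable_negLogSurvival_kernel (κ := κ)
  have hd1 : Measurable fun q : E × ℝ => d (q.2, negLogSurvival (κ q.1) q.2) := by fun_prop
  rw [gluedCoupling, lintegral_map (by fun_prop) measurable_glue,
    lintegral_add_right _ (by fun_prop), Measure.lintegral_compProd (by fun_prop),
    Measure.lintegral_compProd (by fun_prop), lintegral_map _ measurable_fst]
  · simp
  · exact hd1.lintegral_kernel_prod_right'

end Gluing

section Induction

open ProbabilityTheory InformationTheory

variable {n : ℕ}

lemma measurable_cons : Measurable fun q : (Fin n → ℝ) × ℝ =>
    (Fin.cons q.2 q.1 : Fin (n + 1) → ℝ) := by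
  refine measurable_pi_lambda _ fun i => ?_
  refine Fin.cases ?_ (fun j => ?_) i
  · simpa using measurable_snd
  · simp only [Fin.cons_succ]
    fun_prop

lemma measurable_tail_head : Measurable fun x : Fin (n + 1) → ℝ => (Fin.tail x, x 0) :=
  (measurable_pi_lambda _ fun i => measurable_pi_apply i.succ).prodMk (measurable_pi_apply 0)

lemma map_tail_head_pi_expMeasure :
    (Measure.pi fun _ : Fin (n + 1) => expMeasure).map (fun x => (Fin.tail x, x 0)) =
      (Measure.pi fun _ : Fin n => expMeasure).prod expMeasure :=
  (Measure.measurePreserving_swap.comp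
    (measurePreserving_piFinSuccAbove (fun _ : Fin (n + 1) => expMeasure) 0)).map_eq

lemma map_cons_map_tail_head (ν : Measure (Fin (n + 1) → ℝ)) :
    (ν.map fun x => (Fin.tail x, x 0)).map
      (fun q => (Fin.cons q.2 q.1 : Fin (n + 1) → ℝ)) = ν := by
  rw [Measure.map_map measurable_cons measurable_tail_head]
  convert Measure.map_id
  ext x
  simp [Fin.cons_self_tail]

lemma expCost_cons (x y : Fin n → ℝ) (s t : ℝ) :
    expCost (n + 1) (Fin.cons s x : Fin (n + 1) → ℝ) (Fin.cons t y : Fin (n + 1) → ℝ) =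
      ENNReal.ofReal t * expRate (s / t) + expCost n x y := by
  simp [expCost, Fin.sum_univ_succ]

lemma transportCost_le_klDiv_add {κ : Kernel (Fin n → ℝ) ℝ} [IsMarkovKernel κ]
    {ρ : Measure (Fin n → ℝ)} [IsProbabilityMeasure ρ] {ν : Measure (Fin (n + 1) → ℝ)}
    (hν : (ρ ⊗ₘ κ).map (fun q => (Fin.cons q.2 q.1 : Fin (n + 1) → ℝ)) = ν)
    (hac : ∀ᵐ x ∂ρ, κ x ≪ expMeasure) :
    transportCost (expCost (n + 1)) ν (Measure.pi fun _ => expMeasure) ≤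
      ∫⁻ x, klDiv (κ x) expMeasure ∂ρ +
        transportCost (expCost n) ρ (Measure.pi fun _ => expMeasure) := by
  conv_rhs => rw [transportCost]
  simp only [ENNReal.add_iInf]
  refine le_iInf fun P => le_iInf fun h1 => le_iInf fun h2 => ?_
  have : IsProbabilityMeasure P := by
    have : IsProbabilityMeasure (P.map Prod.fst) := h1 ▸ inferInstance
    exact Measure.isProbabilityMeasure_of_map Prod.fst
  have hm : Measurable fun q : ((Fin n → ℝ) × ℝ) × ((Fin n → ℝ) × ℝ) =>
      ((Fin.cons q.1.2 q.1.1 : Fin (n + 1) → ℝ), (Fin.cons q.2.2 q.2.1 : Fin (n + 1) → ℝ)) :=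
    (measurable_cons.comp measurable_fst).prodMk (measurable_cons.comp measurable_snd)
  refine iInf_le_of_le ((gluedCoupling κ P).map fun q =>
    ((Fin.cons q.1.2 q.1.1 : Fin (n + 1) → ℝ), (Fin.cons q.2.2 q.2.1 : Fin (n + 1) → ℝ)))
    (iInf_le_of_le ?_ (iInf_le_of_le ?_ ?_))
  · rw [Measure.map_map measurable_fst hm, ← hν, ← h1, ← map_fst_gluedCoupling,
      Measure.map_map measurable_cons measurable_fst]
    rfl
  · rw [Measure.map_map measurable_snd hm, ← map_cons_map_tail_head (Measure.pi fun _ => expMeasure),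
      map_tail_head_pi_expMeasure, ← h2, ← map_snd_gluedCoupling (h1.symm ▸ hac),
      Measure.map_map measurable_cons measurable_snd]
    rfl
  · have hr := measurable_expRate
    rw [lintegral_map (measurable_expCost _) hm]
    simp only [expCost_cons]
    rw [lintegral_gluedCoupling (measurable_expCost n)
      (d := fun z => ENNReal.ofReal z.2 * expRate (z.1 / z.2)) (by fun_prop), h1]
    refine add_le_add (lintegral_mono_ae ?_) le_rfl
    filter_upwards [hac] with x hx using lintegral_expRate_le_klDiv hx

end Induction

/-- **Transportation-entropy inequality for the exponential measure.** For every probability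
measure `ν` on `ℝⁿ`, `W_c(ν, ηⁿ) ≤ H(ν | ηⁿ)`. -/
theorem exp_transport_entropy (n : ℕ) (ν : Measure (Fin n → ℝ)) [IsProbabilityMeasure ν] :
    transportCost (expCost n) ν (Measure.pi fun _ : Fin n => expMeasure) ≤
      relEntropy ν (Measure.pi fun _ : Fin n => expMeasure) := by
  rw [relEntropy_eq_klDiv]
  induction n with
  | zero =>
    refine iInf_le_of_le (ν.prod (Measure.pi fun _ : Fin 0 => expMeasure)) ?_
    refine iInf_le_of_le (by simp) (iInf_le_of_le (by simp) ?_)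
    simp [expCost]
  | succ n ih =>
    set ρ := ν.map fun x => (Fin.tail x, x 0) with hρ
    have : IsProbabilityMeasure ρ :=
      Measure.isProbabilityMeasure_map measurable_tail_head.aemeasurable
    have hdis : ρ.fst ⊗ₘ ρ.condKernel = ρ := ρ.disintegrate ρ.condKernel
    have hmap : InformationTheory.klDiv ρ ((Measure.pi fun _ : Fin n => expMeasure).prod expMeasure)
        ≤ InformationTheory.klDiv ν (Measure.pi fun _ : Fin (n + 1) => expMeasure) := by
      rw [hρ, ← map_tail_head_pi_expMeasure]
      exact InformationTheory.klDiv_map_le _ _ measurable_tail_head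
    refine le_trans ?_ hmap
    by_cases hac : ρ ≪ (Measure.pi fun _ : Fin n => expMeasure).prod expMeasure
    swap
    · simp [InformationTheory.klDiv_of_not_ac hac]
    rw [← Measure.compProd_const, ← hdis] at hac ⊢
    have hac' := (Measure.absolutelyContinuous_compProd_iff.1 hac).2
    rw [InformationTheory.klDiv_compProd_eq_add, ← lintegral_klDiv_eq_klDiv_compProd hac',
      add_comm (InformationTheory.klDiv _ _)]
    refine (transportCost_le_klDiv_add (κ := ρ.condKernel) (ρ := ρ.fst) ?_ ?_).trans ?_
    · rw [hdis, hρ, map_cons_map_tail_head]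
    · exact Measure.absolutelyContinuous_compProd_right_iff.1 hac'
    · exact add_le_add le_rfl (ih _)
end

section
/- Let p ∈ (0,1), μ_p = (1-p)δ_{-1} + p δ_1, and let 𝒰 be the uniform probability measure on [-1,1]. Define h_0 = 2p-1, I_p(x) = ((1+x)/2)·log((1+x)/(2p)) + ((1-x)/2)·log((1-x)/(2(1-p))) for x ∈ [-1,1], and the cost w_p(x,u) = Σ_{i=1}^n 2|I_p'(u_i)|·1_{x_i(h_0-u_i)<0} for x ∈ {-1,1}^n, u ∈ [-1,1]^n. Then for every probability measure ν on {-1,1}^n, W_{w_p}(ν, 𝒰^n) ≤ H(ν | μ_p^n). -/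
open MeasureTheory Real Set ENNReal
open scoped Classical

/-- The two-point measure `(1-p) δ_{-1} + p δ_1` on `ℝ`. -/
noncomputable def bernoulliMeasure (p : ℝ) : Measure ℝ :=
  ENNReal.ofReal (1 - p) • Measure.dirac (-1) + ENNReal.ofReal p • Measure.dirac 1

/-- The uniform probability measure on `[-1, 1]`. -/
noncomputable def uniformIcc : Measure ℝ :=
  (2 : ℝ≥0∞)⁻¹ • volume.restrict (Set.Icc (-1 : ℝ) 1)

/-- The cost `w_p(x, u) = ∑ i, 2 |I_p'(u i)| 1_{x i (h₀ - u i) < 0}` with `h₀ = 2p - 1`,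
where `2 |I_p'(u)| = |log ((1+u)(1-p) / ((1-u)p))|` for `u ∈ (-1, 1)`,
and `|I_p'(u)| = +∞` at `u = ± 1` (and outside `[-1,1]`). -/
noncomputable def wCost (p : ℝ) (n : ℕ) (x u : Fin n → ℝ) : ℝ≥0∞ :=
  ∑ i, if x i * ((2 * p - 1) - u i) < 0 then
      (if -1 < u i ∧ u i < 1 then
        ENNReal.ofReal |Real.log ((1 + u i) * (1 - p) / ((1 - u i) * p))| else ⊤)
    else 0

instance : IsProbabilityMeasure uniformIcc := by
  constructor
  rw [uniformIcc, Measure.smul_apply, Measure.restrict_apply_univ, Real.volume_Icc]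
  norm_num
  exact ENNReal.inv_mul_cancel (by norm_num) (by norm_num)

lemma isProbabilityMeasure_bernoulliMeasure {p : ℝ} (hp : p ∈ Set.Ioo (0 : ℝ) 1) :
    IsProbabilityMeasure (bernoulliMeasure p) := by
  constructor
  simp [bernoulliMeasure]
  rw [← ENNReal.ofReal_add (by linarith [hp.2]) hp.1.le]
  simp

/-- The mass given by `bernoulliMeasure p` to the sign encoded by `b`. -/
noncomputable def bernoulliWeight (p : ℝ) (b : Bool) : ℝ := if b then p else 1 - p

/-- The point of `{-1,1}` encoded by `b`. -/
noncomputable def boolSign (b : Bool) : ℝ := if b then 1 else -1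

lemma bernoulliWeight_pos {p : ℝ} (hp : p ∈ Set.Ioo (0 : ℝ) 1) (b : Bool) :
    0 < bernoulliWeight p b := by
  cases b <;> simp [bernoulliWeight, hp.1, hp.2]

lemma bernoulliMeasure_singleton (p : ℝ) (b : Bool) :
    bernoulliMeasure p {boolSign b} = ENNReal.ofReal (bernoulliWeight p b) := by
  cases b <;> norm_num [bernoulliMeasure, bernoulliWeight, boolSign]

lemma uniformIcc_Iio {q : ℝ} (h1 : q ≤ 1) :
    uniformIcc (Set.Iio (2 * q - 1)) = ENNReal.ofReal q := by
  rw [uniformIcc, Measure.smul_apply, Measure.restrict_apply measurableSet_Iio]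
  have : Set.Iio (2 * q - 1) ∩ Set.Icc (-1) 1 = Set.Ico (-1) (2 * q - 1) := by
    ext x
    simp only [Set.mem_inter_iff, Set.mem_Iio, Set.mem_Icc, Set.mem_Ico]
    constructor
    · rintro ⟨a, b, c⟩
      exact ⟨b, a⟩
    · rintro ⟨a, b⟩
      exact ⟨b, a, by linarith⟩
  rw [this, Real.volume_Ico, show (2 : ℝ≥0∞)⁻¹ = ENNReal.ofReal (2⁻¹) by
    rw [ENNReal.ofReal_inv_of_pos (by norm_num)]; norm_num, smul_eq_mul,
    ← ENNReal.ofReal_mul (by norm_num)]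
  congr 1
  ring

/-- The summand of `wCost` on one coordinate. -/
noncomputable def coordCost (p x u : ℝ) : ℝ≥0∞ :=
  if x * ((2 * p - 1) - u) < 0 then
    (if -1 < u ∧ u < 1 then
      ENNReal.ofReal |Real.log ((1 + u) * (1 - p) / ((1 - u) * p))| else ⊤)
  else 0

lemma wCost_succ (p : ℝ) (n : ℕ) (x u : Fin (n + 1) → ℝ) :
    wCost p (n + 1) x u =
      coordCost p (x 0) (u 0) + wCost p n (fun i => x i.succ) (fun i => u i.succ) := by
  rw [wCost, Fin.sum_univ_succ]
  rfl

/-- Twice the rate function `I_p`, up to an additive constant. -/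
noncomputable def ratePrimitive (p u : ℝ) : ℝ :=
  (1 + u) * Real.log (1 + u) + (1 - u) * Real.log (1 - u) + u * (Real.log (1 - p) - Real.log p)

lemma continuous_ratePrimitive (p : ℝ) : Continuous (ratePrimitive p) := by
  have h := Real.continuous_mul_log
  have h1 := h.comp (continuous_const.add continuous_id : Continuous fun u : ℝ => 1 + u)
  have h2 := h.comp (continuous_const.sub continuous_id : Continuous fun u : ℝ => 1 - u)
  exact (h1.add h2).add (by fun_prop)

lemma hasDerivAt_ratePrimitive {p u : ℝ} (hp : p ∈ Set.Ioo (0 : ℝ) 1) (hu : u ∈ Set.Ioo (-1 : ℝ) 1) :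
    HasDerivAt (ratePrimitive p) (Real.log ((1 + u) * (1 - p) / ((1 - u) * p))) u := by
  obtain ⟨hp0, hp1⟩ := hp
  obtain ⟨hu0, hu1⟩ := hu
  have e1 : 0 < 1 + u := by linarith
  have e2 : 0 < 1 - u := by linarith
  have e3 : 0 < 1 - p := by linarith
  have h1 := (Real.hasDerivAt_mul_log e1.ne').comp u ((hasDerivAt_id u).const_add 1)
  have h2 := (Real.hasDerivAt_mul_log e2.ne').comp u ((hasDerivAt_id u).const_sub 1)
  have h3 := (hasDerivAt_id u).mul_const (Real.log (1 - p) - Real.log p)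
  refine ((h1.add h2).add h3).congr_deriv ?_
  rw [Real.log_div (by positivity) (by positivity), Real.log_mul e1.ne' e3.ne',
    Real.log_mul e2.ne' hp0.ne']
  ring

lemma ratePrimitive_sub {p q : ℝ} (hp : p ∈ Set.Ioo (0 : ℝ) 1) :
    ratePrimitive p (2 * q - 1) - ratePrimitive p (2 * p - 1) =
      2 * (q * Real.log (q / p) + (1 - q) * Real.log ((1 - q) / (1 - p))) := by
  obtain ⟨hp0, hp1⟩ := hp
  have e3 : 0 < 1 - p := by linarith
  have h2 : ∀ t : ℝ, t * Real.log (2 * t) = t * (Real.log 2 + Real.log t) := by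
    intro t
    rcases eq_or_ne t 0 with rfl | ht
    · simp
    · rw [Real.log_mul two_ne_zero ht]
  have h3 : ∀ t s : ℝ, s ≠ 0 → t * Real.log (t / s) = t * (Real.log t - Real.log s) := by
    intro t s hs
    rcases eq_or_ne t 0 with rfl | ht
    · simp
    · rw [Real.log_div ht hs]
  rw [h3 _ _ hp0.ne', h3 _ _ e3.ne']
  simp only [ratePrimitive]
  rw [show 1 + (2 * q - 1) = 2 * q by ring, show 1 + (2 * p - 1) = 2 * p by ring,
    show 1 - (2 * q - 1) = 2 * (1 - q) by ring, show 1 - (2 * p - 1) = 2 * (1 - p) by ring]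
  linear_combination 2 * h2 q + 2 * h2 (1 - q) - 2 * h2 p - 2 * h2 (1 - p)

lemma lintegral_deriv_le {a b : ℝ} (hab : a ≤ b) {g g' : ℝ → ℝ} (hg : ContinuousOn g (Set.Icc a b))
    (hd : ∀ x ∈ Set.Ioo a b, HasDerivAt g (g' x) x) (hnn : ∀ x ∈ Set.Ioo a b, 0 ≤ g' x) :
    ∫⁻ x in Set.Ioo a b, ENNReal.ofReal (g' x) ≤ ENNReal.ofReal (g b - g a) := by
  have hi : IntervalIntegrable g' volume a b :=
    (intervalIntegrable_iff_integrableOn_Ioc_of_le hab).2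
      (intervalIntegral.integrableOn_deriv_of_nonneg hg hd hnn)
  have hint := intervalIntegral.integral_eq_sub_of_hasDerivAt_of_le hab hg hd hi
  rw [← hint, intervalIntegral.integral_of_le hab, integral_Ioc_eq_integral_Ioo,
    ofReal_integral_eq_lintegral_ofReal]
  · exact ((intervalIntegrable_iff_integrableOn_Ioo_of_le hab).1 hi)
  · exact (ae_restrict_iff' measurableSet_Ioo).2 (Filter.Eventually.of_forall hnn)

lemma measurable_coordCost (p x : ℝ) : Measurable (coordCost p x) := by
  unfold coordCost
  refine Measurable.ite (measurableSet_lt (f := fun u => x * (2 * p - 1 - u)) (by fun_prop)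
    measurable_const) ?_ measurable_const
  exact Measurable.ite ((measurableSet_lt measurable_const measurable_id).inter
    (measurableSet_lt measurable_id measurable_const)) (by fun_prop) measurable_const

lemma lintegral_uniformIcc (f : ℝ → ℝ≥0∞) :
    ∫⁻ u, f u ∂uniformIcc = 2⁻¹ * ∫⁻ u in Set.Ioo (-1 : ℝ) 1, f u := by
  rw [uniformIcc, lintegral_smul_measure, smul_eq_mul,
    Measure.restrict_congr_set Ioo_ae_eq_Icc]

lemma log_odds_nonneg {p u : ℝ} (hp : p ∈ Set.Ioo (0 : ℝ) 1) (hu : u < 1) (h : 2 * p - 1 ≤ u) :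
    0 ≤ Real.log ((1 + u) * (1 - p) / ((1 - u) * p)) := by
  have h1 : 0 < (1 - u) * p := mul_pos (by linarith) hp.1
  exact Real.log_nonneg ((one_le_div h1).2 (by linarith))

lemma log_odds_nonpos {p u : ℝ} (hp : p ∈ Set.Ioo (0 : ℝ) 1) (hu : u ∈ Set.Ioo (-1 : ℝ) 1)
    (h : u ≤ 2 * p - 1) : Real.log ((1 + u) * (1 - p) / ((1 - u) * p)) ≤ 0 := by
  have h1 : 0 < (1 - u) * p := mul_pos (by linarith [hu.2]) hp.1
  have h2 : 0 < (1 + u) * (1 - p) := mul_pos (by linarith [hu.1]) (by linarith [hp.2])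
  exact Real.log_nonpos (by positivity) ((div_le_one h1).2 (by linarith))

lemma two_inv_mul_ofReal (x : ℝ) : 2⁻¹ * ENNReal.ofReal (2 * x) = ENNReal.ofReal x := by
  rw [ENNReal.ofReal_mul (by norm_num), ← mul_assoc, ENNReal.ofReal_ofNat,
    ENNReal.inv_mul_cancel (by norm_num) (by norm_num), one_mul]

/-- The monotone coupling of a two-point measure with the uniform measure. -/
lemma lintegral_coordCost_le {p q : ℝ} (hp : p ∈ Set.Ioo (0 : ℝ) 1) (hq0 : 0 ≤ q) (hq1 : q ≤ 1) :
    ∫⁻ u, coordCost p (boolSign (decide (u < 2 * q - 1))) u ∂uniformIcc ≤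
      ENNReal.ofReal (q * Real.log (q / p) + (1 - q) * Real.log ((1 - q) / (1 - p))) := by
  obtain ⟨hp0, hp1⟩ := id hp
  rw [lintegral_uniformIcc, ← two_inv_mul_ofReal, ← ratePrimitive_sub hp]
  gcongr
  rcases le_total p q with hpq | hpq
  · refine le_trans ?_ (lintegral_deriv_le (g := ratePrimitive p) (a := 2 * p - 1)
      (b := 2 * q - 1) (by linarith)
      (continuous_ratePrimitive p).continuousOn
      (fun u hu => hasDerivAt_ratePrimitive hp ⟨by linarith [hu.1], by linarith [hu.2]⟩)
      (fun u hu => log_odds_nonneg hp (hu.2.trans_le (by linarith)) hu.1.le))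
    rw [← lintegral_indicator (s := Set.Ioo (2 * p - 1) (2 * q - 1)) measurableSet_Ioo]
    refine (setLIntegral_mono' measurableSet_Ioo fun u hu => ?_).trans
      (setLIntegral_le_lintegral _ _)
    unfold coordCost
    split_ifs with h1
    · by_cases h2 : u < 2 * q - 1
      · simp only [h2, decide_true, boolSign, if_true, one_mul] at h1
        rw [Set.indicator_of_mem (show u ∈ Set.Ioo (2 * p - 1) (2 * q - 1) from
          ⟨by linarith, h2⟩), abs_of_nonneg (log_odds_nonneg hp hu.2 (by linarith))]
      · simp [h2, boolSign] at h1
        linarith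
    · exact absurd hu (by assumption)
    · exact zero_le
  · have h := lintegral_deriv_le (a := 2 * q - 1) (b := 2 * p - 1) (by linarith)
      (g := fun u => -ratePrimitive p u) (continuous_ratePrimitive p).neg.continuousOn
      (fun u hu => (hasDerivAt_ratePrimitive hp
        ⟨by linarith [hu.1], by linarith [hu.2]⟩).neg)
      (fun u hu => neg_nonneg.2
        (log_odds_nonpos hp ⟨by linarith [hu.1], by linarith [hu.2]⟩ hu.2.le))
    simp only [neg_sub_neg] at h
    refine le_trans ?_ h
    rw [Measure.restrict_congr_set
      (Ioo_ae_eq_Ico (μ := volume) (a := 2 * q - 1) (b := 2 * p - 1)),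
      ← lintegral_indicator measurableSet_Ico]
    refine (setLIntegral_mono' measurableSet_Ioo fun u hu => ?_).trans
      (setLIntegral_le_lintegral _ _)
    unfold coordCost
    split_ifs with h1
    · by_cases h2 : u < 2 * q - 1
      · simp only [h2, decide_true, boolSign, if_true, one_mul] at h1
        linarith
      · simp [h2, boolSign] at h1
        rw [Set.indicator_of_mem (show u ∈ Set.Ico (2 * q - 1) (2 * p - 1) from
          ⟨by linarith, by linarith⟩), abs_of_nonpos (log_odds_nonpos hp hu (by linarith))]
    · exact absurd hu (by assumption)
    · exact zero_le

lemma sum_fin_succ_bool {n : ℕ} (g : (Fin (n + 1) → Bool) → ℝ) :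
    ∑ b, g b = ∑ a : Bool, ∑ c : Fin n → Bool, g (Fin.cons a c) := by
  rw [← (Fin.consEquiv fun _ : Fin (n + 1) => Bool).sum_comp, Fintype.sum_prod_type]
  rfl

lemma sum_mul_log_div_nonneg {ι : Type*} [Fintype ι] {f m : ι → ℝ} (hf : ∀ i, 0 ≤ f i)
    (hm : ∀ i, 0 < m i) (hfm : ∑ i, m i ≤ ∑ i, f i) : 0 ≤ ∑ i, f i * Real.log (f i / m i) := by
  have h : ∀ i, f i - m i ≤ f i * Real.log (f i / m i) := by
    intro i
    rcases (hf i).eq_or_lt with h0 | h0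
    · rw [← h0]
      simpa using (hm i).le
    · have h1 := Real.one_sub_inv_le_log_of_pos (div_pos h0 (hm i))
      have h2 := mul_le_mul_of_nonneg_left h1 h0.le
      rw [inv_div, mul_sub, mul_one, mul_div_cancel₀ _ h0.ne'] at h2
      exact h2
  have := Finset.sum_le_sum fun i (_ : i ∈ Finset.univ) => h i
  rw [Finset.sum_sub_distrib] at this
  linarith

/-- Chain rule for the relative entropy with respect to a Bernoulli product measure. -/
lemma sum_mul_log_div_succ {p : ℝ} (hp : p ∈ Set.Ioo (0 : ℝ) 1) {n : ℕ}
    {f : (Fin (n + 1) → Bool) → ℝ} (hf : ∀ b, 0 ≤ f b) {q : Bool → ℝ}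
    (hq : ∀ a, ∑ c : Fin n → Bool, f (Fin.cons a c) = q a) :
    ∑ b, f b * Real.log (f b / ∏ i, bernoulliWeight p (b i)) =
      ∑ a, q a * Real.log (q a / bernoulliWeight p a) +
      ∑ a, q a * ∑ c : Fin n → Bool, (f (Fin.cons a c) / q a) *
        Real.log (f (Fin.cons a c) / q a / ∏ i, bernoulliWeight p (c i)) := by
  rw [sum_fin_succ_bool, ← Finset.sum_add_distrib]
  refine Finset.sum_congr rfl fun a _ => ?_
  rw [← hq a, Finset.sum_mul, hq a, Finset.mul_sum, ← Finset.sum_add_distrib]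
  refine Finset.sum_congr rfl fun c _ => ?_
  rcases (hf (Fin.cons a c)).eq_or_lt with h0 | h0
  · simp [← h0]
  · have hqa : 0 < q a := by
      rw [← hq a]
      exact h0.trans_le (Finset.single_le_sum (f := fun c => f (Fin.cons a c))
        (fun c _ => hf _) (Finset.mem_univ c))
    have hw := bernoulliWeight_pos hp a
    have hm : 0 < ∏ i, bernoulliWeight p (c i) :=
      Finset.prod_pos fun i _ => bernoulliWeight_pos hp _
    rw [Fin.prod_univ_succ]
    simp only [Fin.cons_zero, Fin.cons_succ]
    rw [Real.log_div h0.ne' (by positivity), Real.log_mul hw.ne' hm.ne',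
      Real.log_div hqa.ne' hw.ne', Real.log_div (by positivity) hm.ne',
      Real.log_div h0.ne' hqa.ne']
    field_simp
    ring

lemma uniformIcc_threshold {q : Bool → ℝ} (hq0 : ∀ a, 0 ≤ q a) (hq : q true + q false = 1)
    (a : Bool) :
    uniformIcc ((fun u : ℝ => decide (u < 2 * q true - 1)) ⁻¹' {a}) = ENNReal.ofReal (q a) := by
  have h := uniformIcc_Iio (q := q true) (by linarith [hq0 false])
  cases a
  · have : (fun u : ℝ => decide (u < 2 * q true - 1)) ⁻¹' {false} =
        (Set.Iio (2 * q true - 1))ᶜ := by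
      ext u
      simp
    rw [this, prob_compl_eq_one_sub measurableSet_Iio, h, ← ENNReal.ofReal_one,
      ← ENNReal.ofReal_sub _ (hq0 true)]
    congr 1
    linarith
  · rw [← h]
    congr 1
    ext u
    simp

/-- The triangular (Knothe-type) map transporting the uniform measure on the cube to a measure
with weights `f` on the discrete cube has cost at most the relative entropy. -/
lemma exists_triangular_map {p : ℝ} (hp : p ∈ Set.Ioo (0 : ℝ) 1) (n : ℕ) :
    ∀ f : (Fin n → Bool) → ℝ, (∀ b, 0 ≤ f b) → ∑ b, f b = 1 →
      0 ≤ ∑ b, f b * Real.log (f b / ∏ i, bernoulliWeight p (b i)) ∧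
      ∃ X : (Fin n → ℝ) → Fin n → Bool, Measurable X ∧
        (∀ b, Measure.pi (fun _ : Fin n => uniformIcc) (X ⁻¹' {b}) = ENNReal.ofReal (f b)) ∧
        ∫⁻ u, wCost p n (fun i => boolSign (X u i)) u ∂Measure.pi (fun _ : Fin n => uniformIcc) ≤
          ENNReal.ofReal (∑ b, f b * Real.log (f b / ∏ i, bernoulliWeight p (b i))) := by
  induction n with
  | zero =>
    intro f hf h1
    rw [Fintype.sum_unique] at h1
    refine ⟨by simp [h1], fun _ => default, measurable_const, fun b => ?_, ?_⟩
    · rw [Subsingleton.elim b default,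
        show f default = 1 from (congrArg f (Subsingleton.elim _ _)).trans h1]
      simp
    · simp [wCost]
  | succ n ih =>
    intro f hf h1
    set q : Bool → ℝ := fun a => ∑ c : Fin n → Bool, f (Fin.cons a c) with hqdef
    have hq0 : ∀ a, 0 ≤ q a := fun a => Finset.sum_nonneg fun c _ => hf _
    have hq1 : q true + q false = 1 := by
      rw [← h1, sum_fin_succ_bool, Fintype.sum_bool]
    have hchain := sum_mul_log_div_succ hp hf (q := q) fun a => rfl
    set H : Bool → ℝ := fun a => ∑ c : Fin n → Bool, (f (Fin.cons a c) / q a) *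
        Real.log (f (Fin.cons a c) / q a / ∏ i, bernoulliWeight p (c i)) with hHdef
    have hex : ∀ a, ∃ Y : (Fin n → ℝ) → Fin n → Bool, Measurable Y ∧ (q a ≠ 0 →
        0 ≤ H a ∧
        (∀ c, Measure.pi (fun _ : Fin n => uniformIcc) (Y ⁻¹' {c}) =
          ENNReal.ofReal (f (Fin.cons a c) / q a)) ∧
        ∫⁻ u, wCost p n (fun i => boolSign (Y u i)) u ∂Measure.pi (fun _ : Fin n => uniformIcc) ≤
          ENNReal.ofReal (H a)) := by
      intro a
      by_cases ha : q a = 0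
      · exact ⟨fun _ _ => true, measurable_const, fun h => absurd ha h⟩
      · obtain ⟨h0, Y, hY, hY1, hY2⟩ := ih (fun c => f (Fin.cons a c) / q a)
          (fun c => div_nonneg (hf _) (hq0 a)) (by rw [← Finset.sum_div]; exact div_self ha)
        exact ⟨Y, hY, fun _ => ⟨h0, hY1, hY2⟩⟩
    choose Y hY hYq using hex
    have hqH : ∀ a, 0 ≤ q a * H a := by
      intro a
      by_cases ha : q a = 0
      · simp [ha]
      · exact mul_nonneg (hq0 a) (hYq a ha).1
    have hE0 : 0 ≤ ∑ a, q a * Real.log (q a / bernoulliWeight p a) :=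
      sum_mul_log_div_nonneg hq0 (bernoulliWeight_pos hp) (by
        rw [Fintype.sum_bool, Fintype.sum_bool, hq1]
        simp [bernoulliWeight])
    have hH0 : 0 ≤ ∑ a, q a * H a := Finset.sum_nonneg fun a _ => hqH a
    rw [hchain]
    refine ⟨add_nonneg hE0 hH0, ?_⟩
    set T : ℝ → Bool := fun u => decide (u < 2 * q true - 1) with hT
    have hTm : Measurable T := measurable_to_bool (by
      have : T ⁻¹' {true} = Set.Iio (2 * q true - 1) := by
        ext u
        simp [hT]
      rw [this]
      exact measurableSet_Iio)
    have hTU : ∀ a, uniformIcc (T ⁻¹' {a}) = ENNReal.ofReal (q a) :=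
      uniformIcc_threshold hq0 hq1
    have hYm : Measurable fun z : Bool × (Fin n → ℝ) => Y z.1 z.2 :=
      measurable_from_prod_countable_right hY
    have hmp := measurePreserving_piFinSuccAbove (fun _ : Fin (n + 1) => uniformIcc) 0
    refine ⟨fun w => Fin.cons (T (w 0)) (Y (T (w 0)) fun i => w i.succ), ?_, ?_, ?_⟩
    · refine measurable_pi_iff.2 fun i => ?_
      refine Fin.cases ?_ (fun j => ?_) i
      · exact hTm.comp (measurable_pi_apply 0)
      · have h3 : Measurable fun w : Fin (n + 1) → ℝ => (T (w 0), fun i : Fin n => w i.succ) :=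
          (hTm.comp (measurable_pi_apply 0)).prodMk
            (measurable_pi_iff.2 fun i => measurable_pi_apply _)
        exact (measurable_pi_apply j).comp (hYm.comp h3)
    · intro b
      have hpre : (fun w : Fin (n + 1) → ℝ =>
            (Fin.cons (T (w 0)) (Y (T (w 0)) fun i => w i.succ) : Fin (n + 1) → Bool)) ⁻¹' {b} =
          MeasurableEquiv.piFinSuccAbove (fun _ : Fin (n + 1) => ℝ) 0 ⁻¹'
            ((T ⁻¹' {b 0}) ×ˢ (Y (b 0) ⁻¹' {Fin.tail b})) := by
        ext w
        have hw : MeasurableEquiv.piFinSuccAbove (fun _ : Fin (n + 1) => ℝ) 0 w =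
          (w 0, fun i => w i.succ) := rfl
        rw [Set.mem_preimage, Set.mem_preimage, hw, Set.mem_singleton_iff, Set.mem_prod]
        simp only [Set.mem_preimage, Set.mem_singleton_iff]
        constructor
        · intro h
          have h0 : T (w 0) = b 0 := by rw [← h]; rfl
          refine ⟨h0, ?_⟩
          rw [← h0, ← h]
          rfl
        · rintro ⟨h0, h2⟩
          rw [h0, h2, Fin.cons_self_tail]
      rw [hpre, hmp.measure_preimage_equiv, Measure.prod_prod, hTU]
      have hb : (Fin.cons (b 0) (Fin.tail b) : Fin (n + 1) → Bool) = b := Fin.cons_self_tail b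
      by_cases ha : q (b 0) = 0
      · have hle : f b ≤ q (b 0) := by
          conv_lhs => rw [← hb]
          exact Finset.single_le_sum (f := fun c => f (Fin.cons (b 0) c))
            (fun c _ => hf _) (Finset.mem_univ _)
        rw [ha, le_antisymm (ha ▸ hle) (hf b)]
        simp
      · rw [(hYq _ ha).2.1, ← ENNReal.ofReal_mul (hq0 _), hb, mul_div_cancel₀ _ ha]
    · set K : Bool → ℝ≥0∞ := fun a => ∫⁻ u, wCost p n (fun i => boolSign (Y a u i)) u
        ∂Measure.pi (fun _ : Fin n => uniformIcc) with hK
      have hKle : ∫⁻ x, K (T x) ∂uniformIcc ≤ ENNReal.ofReal (∑ a, q a * H a) := by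
        rw [← lintegral_map (measurable_of_finite K) hTm, lintegral_fintype,
          ENNReal.ofReal_sum_of_nonneg fun a _ => hqH a]
        refine Finset.sum_le_sum fun a _ => ?_
        rw [Measure.map_apply hTm (measurableSet_singleton a), hTU]
        by_cases ha : q a = 0
        · simp [ha]
        · rw [ENNReal.ofReal_mul (hq0 a), mul_comm]
          gcongr
          exact (hYq a ha).2.2
      have hcle : ∫⁻ x, coordCost p (boolSign (T x)) x ∂uniformIcc ≤
          ENNReal.ofReal (∑ a, q a * Real.log (q a / bernoulliWeight p a)) := by
        refine (lintegral_coordCost_le hp (hq0 true) (by linarith [hq0 false])).trans_eq ?_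
        rw [Fintype.sum_bool, show q false = 1 - q true by linarith]
        simp [bernoulliWeight]
      rw [ENNReal.ofReal_add hE0 hH0]
      refine le_trans ?_ (add_le_add hcle hKle)
      rw [← lintegral_add_right (g := fun x => K (T x)) _ ((measurable_of_finite K).comp hTm)]
      let F : ℝ × (Fin n → ℝ) → ℝ≥0∞ := fun z => coordCost p (boolSign (T z.1)) z.1 +
        wCost p n (fun i => boolSign (Y (T z.1) z.2 i)) z.2
      have hcost : ∀ w : Fin (n + 1) → ℝ,
          wCost p (n + 1) (fun i => boolSign ((Fin.cons (T (w 0))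
            (Y (T (w 0)) fun i => w i.succ) : Fin (n + 1) → Bool) i)) w =
          F (MeasurableEquiv.piFinSuccAbove (fun _ : Fin (n + 1) => ℝ) 0 w) := by
        intro w
        rw [wCost_succ]
        rfl
      refine (lintegral_congr hcost).trans_le ?_
      refine (hmp.lintegral_comp_emb (MeasurableEquiv.measurableEmbedding _) F).trans_le ?_
      refine (lintegral_prod_le _).trans (lintegral_mono fun x => ?_)
      simp only [F, hK]
      rw [lintegral_add_left measurable_const, lintegral_const, measure_univ, mul_one]

lemma rnDeriv_singleton {E : Type*} [MeasurableSpace E] [MeasurableSingletonClass E]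
    {ν μ : Measure E} [SigmaFinite ν] [SigmaFinite μ] (h : ν ≪ μ) (x : E) :
    ν {x} = ν.rnDeriv μ x * μ {x} := by
  conv_lhs => rw [← Measure.withDensity_rnDeriv_eq ν μ h]
  rw [withDensity_apply _ (measurableSet_singleton x), lintegral_singleton]

/-- **Transportation-entropy inequality on the discrete hypercube.** For every probability
measure `ν` on `{-1,1}ⁿ`, `W_{w_p}(ν, 𝒰ⁿ) ≤ H(ν | μ_pⁿ)`. -/
theorem bernoulli_transport_entropy (p : ℝ) (hp : p ∈ Set.Ioo (0 : ℝ) 1) (n : ℕ)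
    (ν : Measure (Fin n → ℝ)) [IsProbabilityMeasure ν]
    (hsupp : ∀ᵐ x ∂ν, ∀ i, x i = -1 ∨ x i = 1) :
    transportCost (wCost p n) ν (Measure.pi fun _ : Fin n => uniformIcc) ≤
      relEntropy ν (Measure.pi fun _ : Fin n => bernoulliMeasure p) := by
  have := isProbabilityMeasure_bernoulliMeasure hp
  unfold relEntropy
  split_ifs with hac
  swap
  · exact le_top
  obtain ⟨hac, hint⟩ := hac
  set σ : (Fin n → Bool) → Fin n → ℝ := fun b i => boolSign (b i) with hσ
  have hσm : Measurable σ := measurable_of_finite σ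
  obtain ⟨τ, hτm, hτ⟩ : ∃ τ : (Fin n → ℝ) → Fin n → Bool, Measurable τ ∧
      ∀ x : Fin n → ℝ, (∀ i, x i = -1 ∨ x i = 1) → σ (τ x) = x := by
    refine ⟨fun x i => decide (x i = 1), measurable_pi_iff.2 fun i => measurable_to_bool ?_,
      fun x hx => ?_⟩
    · have : (fun x : Fin n → ℝ => decide (x i = 1)) ⁻¹' {true} = (fun x => x i) ⁻¹' {1} := by
        ext x
        simp
      rw [this]
      exact measurable_pi_apply i (measurableSet_singleton 1)
    · funext i
      rcases hx i with h | h <;> norm_num [hσ, boolSign, h]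
  set ρ := ν.map τ with hρ
  have : IsProbabilityMeasure ρ := Measure.isProbabilityMeasure_map hτm.aemeasurable
  have hρν : ρ.map σ = ν := by
    rw [hρ, Measure.map_map hσm hτm]
    conv_rhs => rw [← Measure.map_id (μ := ν)]
    exact Measure.map_congr (hsupp.mono hτ)
  have hσinj : Function.Injective σ := by
    intro b c h
    funext i
    have := congrFun h i
    revert this
    cases hb : b i <;> cases hc : c i <;> norm_num [hσ, boolSign, hb, hc]
  have hνσ : ∀ b, ν {σ b} = ρ {b} := by
    intro b
    rw [← hρν, Measure.map_apply hσm (measurableSet_singleton _),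
      ← Set.image_singleton, hσinj.preimage_image]
  have hμσ : ∀ b, Measure.pi (fun _ : Fin n => bernoulliMeasure p) {σ b} =
      ENNReal.ofReal (∏ i, bernoulliWeight p (b i)) := by
    intro b
    rw [Measure.pi_singleton, ENNReal.ofReal_prod_of_nonneg
      fun i _ => (bernoulliWeight_pos hp _).le]
    exact Finset.prod_congr rfl fun i _ => bernoulliMeasure_singleton p (b i)
  have hent : ∫ x, Real.log ((ν.rnDeriv (Measure.pi fun _ : Fin n => bernoulliMeasure p) x).toReal)
      ∂ν = ∑ b, ρ.real {b} * Real.log (ρ.real {b} / ∏ i, bernoulliWeight p (b i)) := by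
    conv_lhs => rw [← hρν]
    rw [integral_map hσm.aemeasurable (by rw [hρν]; exact hint.aestronglyMeasurable), hρν,
      integral_fintype .of_finite]
    refine Finset.sum_congr rfl fun b _ => ?_
    have hm : 0 < ∏ i, bernoulliWeight p (b i) :=
      Finset.prod_pos fun i _ => bernoulliWeight_pos hp _
    have h := congrArg ENNReal.toReal (rnDeriv_singleton hac (σ b))
    rw [hνσ, hμσ, ENNReal.toReal_mul, ENNReal.toReal_ofReal hm.le] at h
    rw [smul_eq_mul, measureReal_def, h, mul_div_cancel_right₀ _ hm.ne']
  rw [hent]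
  obtain ⟨-, X, hX, hXρ, hXc⟩ := exists_triangular_map hp n (fun b => ρ.real {b})
    (fun b => measureReal_nonneg) (by simp)
  have hmap : (Measure.pi fun _ : Fin n => uniformIcc).map X = ρ := by
    refine Measure.ext_of_singleton fun b => ?_
    rw [Measure.map_apply hX (measurableSet_singleton b), hXρ, ofReal_measureReal]
  have hpair : Measurable fun u : Fin n → ℝ => (σ (X u), u) := (hσm.comp hX).prodMk measurable_id
  refine le_trans ?_ ((lintegral_map_le (fun z => wCost p n z.1 z.2) fun u => (σ (X u), u)).trans
    hXc)
  refine iInf_le_of_le _ (iInf₂_le ?_ ?_)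
  · rw [Measure.map_map measurable_fst hpair, ← hρν, ← hmap, Measure.map_map hσm hX]
    rfl
  · rw [Measure.map_map measurable_snd hpair]
    exact Measure.map_id
end

section
/- Let μ be the uniform probability measure on {-1,1}^n, let J be a real symmetric n×n matrix with J_{ii} = 0 for all i, and let h ∈ ℝ^n. Define I(y) = Σ_{i=1}^n ( ((1+y_i)/2)·log(1+y_i) + ((1-y_i)/2)·log(1-y_i) ) for y ∈ [-1,1]^n. There exists a universal constant κ > 0 such that log ∫ exp( ⟨x,Jx⟩ + ⟨h,x⟩ ) dμ(x) ≤ sup_{y ∈ [-1,1]^n} ( ⟨y,Jy⟩ + ⟨h,y⟩ - I(y) ) + κ · ‖J‖_2 · √n, where ‖J‖_2 = ( Σ_{i,j} |J_{ij}|^2 )^{1/2} is the Hilbert–Schmidt norm. -/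
open MeasureTheory Real Set ENNReal
open scoped Classical

/-- The uniform probability measure on the discrete hypercube `{-1,1}ⁿ`,
viewed as a measure on `ℝⁿ`. -/
noncomputable def cubeUniform (n : ℕ) : Measure (Fin n → ℝ) :=
  Measure.pi fun _ =>
    ((2 : ℝ≥0∞)⁻¹ • Measure.dirac (-1 : ℝ) + (2 : ℝ≥0∞)⁻¹ • Measure.dirac (1 : ℝ))

/-- The logarithmic Laplace transform `Λ_μ(ξ) = log ∫ e^{⟨ξ,x⟩} dμ(x)` of the uniform
measure on `{-1,1}ⁿ`. -/
noncomputable def logLaplaceCube (n : ℕ) (ξ : Fin n → ℝ) : ℝ :=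
  Real.log (∫ x, Real.exp (∑ i, ξ i * x i) ∂cubeUniform n)

/-- The solid hypercube `[-1,1]ⁿ`. -/
def solidCube (n : ℕ) : Set (Fin n → ℝ) := {y | ∀ i, y i ∈ Set.Icc (-1 : ℝ) 1}

/-- `I(y) = ∑ i, ((1+yᵢ)/2) log (1+yᵢ) + ((1-yᵢ)/2) log (1-yᵢ)`, the relative entropy
`H(μ_y | μ)` of the product measure with barycenter `y ∈ [-1,1]ⁿ` with respect to the
uniform measure on `{-1,1}ⁿ`. -/
noncomputable def cubeEnt (n : ℕ) (y : Fin n → ℝ) : ℝ :=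
  ∑ i, ((1 + y i) / 2 * Real.log (1 + y i) + (1 - y i) / 2 * Real.log (1 - y i))

/-- The vertices `{-1,1}ⁿ` of the hypercube. -/
noncomputable def cubeVertices (n : ℕ) : Finset (Fin n → ℝ) :=
  Fintype.piFinset fun _ => {-1, 1}

theorem mem_cubeVertices {n : ℕ} {x : Fin n → ℝ} :
    x ∈ cubeVertices n ↔ ∀ i, x i = -1 ∨ x i = 1 := by
  simp [cubeVertices]

theorem sum_cubeVertices_prod {n : ℕ} (f : Fin n → ℝ → ℝ) :
    ∑ x ∈ cubeVertices n, ∏ i, f i (x i) = ∏ i, (f i (-1) + f i 1) := by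
  rw [cubeVertices, ← Finset.prod_univ_sum]
  refine Finset.prod_congr rfl fun i _ => Finset.sum_pair (by norm_num)

theorem cubeUniform_eq_sum_dirac (n : ℕ) :
    cubeUniform n = ∑ x ∈ cubeVertices n, ((2 : ℝ≥0∞)⁻¹ ^ n) • Measure.dirac x := by
  have : IsProbabilityMeasure
      ((2 : ℝ≥0∞)⁻¹ • Measure.dirac (-1 : ℝ) + (2 : ℝ≥0∞)⁻¹ • Measure.dirac (1 : ℝ)) := by
    constructor
    simp [ENNReal.inv_two_add_inv_two]
  refine Measure.pi_eq fun s hs => ?_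
  have h1 : ∀ i, ((2 : ℝ≥0∞)⁻¹ • Measure.dirac (-1 : ℝ) + (2 : ℝ≥0∞)⁻¹ • Measure.dirac (1 : ℝ))
      (s i) = ∑ y ∈ ({-1, 1} : Finset ℝ), 2⁻¹ * (s i).indicator 1 y := by
    intro i
    rw [Finset.sum_pair (by norm_num)]
    simp [Measure.dirac_apply' _ (hs i)]
  simp_rw [h1, Finset.prod_univ_sum]
  rw [Measure.finsetSum_apply]
  refine Finset.sum_congr rfl fun x _ => ?_
  rw [Finset.prod_mul_distrib, Measure.smul_apply, Measure.dirac_apply' _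
    (MeasurableSet.univ_pi hs)]
  by_cases hx : x ∈ Set.univ.pi s
  · have : ∀ i, x i ∈ s i := fun i => hx i (Set.mem_univ i)
    simp [this]
  · obtain ⟨i, hi⟩ : ∃ i, x i ∉ s i := by simpa using hx
    rw [Finset.prod_eq_zero (f := fun i => (s i).indicator (1 : ℝ → ℝ≥0∞) (x i))
      (Finset.mem_univ i) (Set.indicator_of_notMem hi _)]
    simp [hx]

theorem integral_cubeUniform {n : ℕ} (f : (Fin n → ℝ) → ℝ) :
    ∫ x, f x ∂cubeUniform n = 2⁻¹ ^ n * ∑ x ∈ cubeVertices n, f x := by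
  rw [cubeUniform_eq_sum_dirac, integral_finsetSum_measure, Finset.mul_sum]
  · simp
  · intro x _
    exact (integrable_dirac (by simp)).smul_measure (by simp)

theorem two_point_mgf_le {a : ℝ} (ha : |a| ≤ 1) (w : ℝ) :
    (1 - a) / 2 * Real.exp (w * (-1 - a)) + (1 + a) / 2 * Real.exp (w * (1 - a))
      ≤ Real.exp (2 * w ^ 2) := by
  obtain ⟨h1, h2⟩ := abs_le.1 ha
  set A := (1 - a) / 2 * Real.exp (w * (-1 - a)) + (1 + a) / 2 * Real.exp (w * (1 - a)) with hA
  set B := (1 - a) / 2 * Real.exp (-(w * (-1 - a))) + (1 + a) / 2 * Real.exp (-(w * (1 - a)))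
    with hB
  have hA0 : 0 ≤ A := by
    have := Real.exp_pos (w * (-1 - a)); have := Real.exp_pos (w * (1 - a))
    have : 0 ≤ 1 - a := by linarith
    have : 0 ≤ 1 + a := by linarith
    positivity
  have hB1 : 1 ≤ B := by
    have e1 := mul_le_mul_of_nonneg_left (Real.add_one_le_exp (-(w * (-1 - a))))
      (show 0 ≤ (1 - a) / 2 by linarith)
    have e2 := mul_le_mul_of_nonneg_left (Real.add_one_le_exp (-(w * (1 - a))))
      (show 0 ≤ (1 + a) / 2 by linarith)
    nlinarith
  have hcosh : Real.cosh (2 * w) ≤ Real.exp (2 * w ^ 2) := by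
    refine (Real.cosh_le_exp_half_sq _).trans (le_of_eq ?_)
    ring_nf
  have hAB : A * B = ((1 - a) ^ 2 + (1 + a) ^ 2) / 4 + (1 - a ^ 2) / 2 * Real.cosh (2 * w) := by
    have p1 : Real.exp (w * (-1 - a)) * Real.exp (-(w * (-1 - a))) = 1 := by
      rw [← Real.exp_add]; simp
    have p2 : Real.exp (w * (1 - a)) * Real.exp (-(w * (1 - a))) = 1 := by
      rw [← Real.exp_add]; simp
    have p3 : Real.exp (w * (1 - a)) * Real.exp (-(w * (-1 - a))) = Real.exp (2 * w) := by
      rw [← Real.exp_add]; ring_nf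
    have p4 : Real.exp (w * (-1 - a)) * Real.exp (-(w * (1 - a))) = Real.exp (-(2 * w)) := by
      rw [← Real.exp_add]; ring_nf
    rw [hA, hB, Real.cosh_eq]
    linear_combination ((1 - a) / 2) ^ 2 * p1 + ((1 + a) / 2) ^ 2 * p2
      + (1 - a) / 2 * ((1 + a) / 2) * (p3 + p4)
  have hc1 := Real.one_le_cosh (2 * w)
  nlinarith [mul_le_mul_of_nonneg_left hB1 hA0, sq_nonneg a]

/-- The mass function of the product measure on `{-1,1}ⁿ` with barycenter `a`. -/
noncomputable def cubeProd {n : ℕ} (a x : Fin n → ℝ) : ℝ := ∏ i, (1 + a i * x i) / 2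

theorem sum_cubeProd_mul_exp_le {n : ℕ} {a : Fin n → ℝ} (ha : ∀ i, |a i| ≤ 1) (w : Fin n → ℝ) :
    ∑ x ∈ cubeVertices n, cubeProd a x * Real.exp (∑ i, w i * (x i - a i))
      ≤ Real.exp (2 * ∑ i, w i ^ 2) := by
  have : ∀ x : Fin n → ℝ, cubeProd a x * Real.exp (∑ i, w i * (x i - a i))
      = ∏ i, ((1 + a i * x i) / 2 * Real.exp (w i * (x i - a i))) := by
    intro x
    rw [cubeProd, Real.exp_sum, Finset.prod_mul_distrib]
  simp_rw [this]
  rw [sum_cubeVertices_prod fun i y => (1 + a i * y) / 2 * Real.exp (w i * (y - a i)),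
    Finset.mul_sum, Real.exp_sum]
  refine Finset.prod_le_prod (fun i _ => ?_) fun i _ => ?_
  · obtain ⟨h1, h2⟩ := abs_le.1 (ha i)
    have : 0 ≤ 1 + a i * -1 := by linarith
    have : 0 ≤ 1 + a i * 1 := by linarith
    positivity
  · refine le_trans (le_of_eq ?_) (two_point_mgf_le (ha i) (w i))
    ring_nf

theorem exp_mul_sq_eq_integral {l : ℝ} (hl : 0 ≤ l) (u : ℝ) :
    ∫ t : ℝ, Real.exp (-t ^ 2 + 2 * √l * t * u) = √π * Real.exp (l * u ^ 2) := by
  have : ∀ t : ℝ, Real.exp (-t ^ 2 + 2 * √l * t * u)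
      = Real.exp (-1 * (t - √l * u) ^ 2) * Real.exp (l * u ^ 2) := by
    intro t
    rw [← Real.exp_add]
    congr 1
    linear_combination (u ^ 2) * Real.sq_sqrt hl
  simp_rw [this]
  rw [integral_mul_const, integral_sub_right_eq_self (fun t => Real.exp (-1 * t ^ 2)),
    integral_gaussian]
  simp

theorem integrable_exp_neg_sq_add (c : ℝ) :
    Integrable fun t : ℝ => Real.exp (-t ^ 2 + 2 * c * t) := by
  have : ∀ t : ℝ, Real.exp (-t ^ 2 + 2 * c * t)
      = Real.exp (-1 * (t - c) ^ 2) * Real.exp (c ^ 2) := by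
    intro t
    rw [← Real.exp_add]
    congr 1
    ring
  simp_rw [this]
  exact ((integrable_exp_neg_mul_sq one_pos).comp_sub_right c).mul_const _

theorem sqrt_pi_div_le {l : ℝ} (hl0 : 0 ≤ l) (hl : l ≤ 1 / 16) :
    √(π / (1 - 8 * l)) ≤ √π * Real.exp (8 * l) := by
  have h1 : 0 < 1 - 8 * l := by linarith
  rw [Real.sqrt_div Real.pi_pos.le, div_le_iff₀ (Real.sqrt_pos.2 h1), mul_assoc]
  refine le_mul_of_one_le_right (Real.sqrt_nonneg _) ?_
  rw [← one_le_sq_iff₀ (by positivity), mul_pow, Real.sq_sqrt h1.le, ← Real.exp_nat_mul]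
  have := Real.add_one_le_exp (((2 : ℕ) : ℝ) * (8 * l))
  push_cast at this ⊢
  nlinarith

/-- Sub-Gaussian Laplace transforms control the exponential moments of small quadratic forms. -/
theorem sum_mul_exp_quadratic_le {ι : Type*} {m : ℕ} (s : Finset ι) (q : ι → ℝ)
    (u : ι → Fin m → ℝ)
    (hu : ∀ t : Fin m → ℝ,
      ∑ x ∈ s, q x * Real.exp (∑ i, t i * u x i) ≤ Real.exp (2 * ∑ i, t i ^ 2))
    (l : Fin m → ℝ) (hl0 : ∀ i, 0 ≤ l i) (hl : ∀ i, l i ≤ 1 / 16) :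
    ∑ x ∈ s, q x * Real.exp (∑ i, l i * u x i ^ 2) ≤ Real.exp (8 * ∑ i, l i) := by
  have hpi : 0 < √π := Real.sqrt_pos.2 Real.pi_pos
  have hint : ∀ x, Integrable fun t : Fin m → ℝ =>
      ∏ i, Real.exp (-t i ^ 2 + 2 * √(l i) * t i * u x i) := by
    intro x
    refine Integrable.fintype_prod
      (f := fun i (t : ℝ) => Real.exp (-t ^ 2 + 2 * √(l i) * t * u x i)) fun i => ?_
    convert integrable_exp_neg_sq_add (√(l i) * u x i) using 3
    ring
  have hrep : ∀ x, √π ^ m * Real.exp (∑ i, l i * u x i ^ 2)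
      = ∫ t : Fin m → ℝ, ∏ i, Real.exp (-t i ^ 2 + 2 * √(l i) * t i * u x i) := by
    intro x
    rw [integral_fintype_prod_volume_eq_prod
      (fun i (t : ℝ) => Real.exp (-t ^ 2 + 2 * √(l i) * t * u x i))]
    simp_rw [exp_mul_sq_eq_integral (hl0 _)]
    rw [Finset.prod_mul_distrib, Real.exp_sum]
    simp
  have hpos : ∀ i, 0 < 1 - 8 * l i := fun i => by linarith [hl i]
  have hint' : Integrable fun t : Fin m → ℝ => ∏ i, Real.exp (-(1 - 8 * l i) * t i ^ 2) :=
    Integrable.fintype_prod (f := fun i (t : ℝ) => Real.exp (-(1 - 8 * l i) * t ^ 2))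
      fun i => integrable_exp_neg_mul_sq (hpos i)
  have key : √π ^ m * ∑ x ∈ s, q x * Real.exp (∑ i, l i * u x i ^ 2)
      ≤ √π ^ m * Real.exp (8 * ∑ i, l i) := by
    calc √π ^ m * ∑ x ∈ s, q x * Real.exp (∑ i, l i * u x i ^ 2)
        = ∑ x ∈ s, q x * ∫ t : Fin m → ℝ,
            ∏ i, Real.exp (-t i ^ 2 + 2 * √(l i) * t i * u x i) := by
          rw [Finset.mul_sum]
          refine Finset.sum_congr rfl fun x _ => ?_
          rw [← hrep]; ring
      _ = ∫ t : Fin m → ℝ, ∑ x ∈ s,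
            q x * ∏ i, Real.exp (-t i ^ 2 + 2 * √(l i) * t i * u x i) := by
          rw [integral_finsetSum _ fun x _ => (hint x).const_mul _]
          simp_rw [integral_const_mul]
      _ ≤ ∫ t : Fin m → ℝ, ∏ i, Real.exp (-(1 - 8 * l i) * t i ^ 2) := by
          refine integral_mono (integrable_finsetSum _ fun x _ => (hint x).const_mul _) hint' ?_
          intro t
          have h1 : ∀ x, q x * ∏ i, Real.exp (-t i ^ 2 + 2 * √(l i) * t i * u x i)
              = Real.exp (-∑ i, t i ^ 2)
                * (q x * Real.exp (∑ i, 2 * √(l i) * t i * u x i)) := by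
            intro x
            rw [← Real.exp_sum, Finset.sum_add_distrib, Finset.sum_neg_distrib, Real.exp_add]
            ring
          have h2 : ∏ i, Real.exp (-(1 - 8 * l i) * t i ^ 2)
              = Real.exp (-∑ i, t i ^ 2)
                * Real.exp (2 * ∑ i, (2 * √(l i) * t i) ^ 2) := by
            rw [← Real.exp_sum, ← Real.exp_add, Finset.mul_sum, ← Finset.sum_neg_distrib,
              ← Finset.sum_add_distrib]
            congr 1
            refine Finset.sum_congr rfl fun i _ => ?_
            linear_combination (-8 * t i ^ 2) * Real.sq_sqrt (hl0 i)
          simp only [h1, h2]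
          rw [← Finset.mul_sum]
          exact mul_le_mul_of_nonneg_left (hu _) (Real.exp_pos _).le
      _ = ∏ i, √(π / (1 - 8 * l i)) := by
          rw [integral_fintype_prod_volume_eq_prod
            (fun i (t : ℝ) => Real.exp (-(1 - 8 * l i) * t ^ 2))]
          simp_rw [integral_gaussian]
      _ ≤ ∏ i, (√π * Real.exp (8 * l i)) :=
          Finset.prod_le_prod (fun i _ => Real.sqrt_nonneg _)
            fun i _ => sqrt_pi_div_le (hl0 i) (hl i)
      _ = √π ^ m * Real.exp (8 * ∑ i, l i) := by
          rw [Finset.prod_mul_distrib, Finset.mul_sum, Real.exp_sum]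
          simp
  exact le_of_mul_le_mul_left key (by positivity)

theorem exists_orthogonal_diagonalization {n : ℕ} {J : Matrix (Fin n) (Fin n) ℝ}
    (hJ : J.IsSymm) :
    ∃ (e : Matrix (Fin n) (Fin n) ℝ) (l : Fin n → ℝ),
      e * e.transpose = 1 ∧ e.transpose * e = 1 ∧
        J = e.transpose * Matrix.diagonal l * e := by
  have hH : J.IsHermitian := by
    rw [Matrix.IsHermitian, Matrix.conjTranspose_eq_transpose_of_trivial]; exact hJ
  have hU := hH.eigenvectorUnitary.2
  rw [Matrix.mem_unitaryGroup_iff] at hU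
  have hU' := mul_eq_one_comm.1 hU
  have hs := hH.spectral_theorem
  rw [Unitary.conjStarAlgAut_apply] at hs
  refine ⟨star (hH.eigenvectorUnitary : Matrix (Fin n) (Fin n) ℝ), hH.eigenvalues, ?_, ?_, ?_⟩
  · simpa [Matrix.star_eq_conjTranspose, Matrix.conjTranspose_eq_transpose_of_trivial] using hU'
  · simpa [Matrix.star_eq_conjTranspose, Matrix.conjTranspose_eq_transpose_of_trivial] using hU
  · simpa [Matrix.star_eq_conjTranspose, Matrix.conjTranspose_eq_transpose_of_trivial,
      Function.comp_def] using hs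

theorem sum_mulVec_sq {n : ℕ} {e : Matrix (Fin n) (Fin n) ℝ} (he : e.transpose * e = 1)
    (x : Fin n → ℝ) : ∑ i, (e.mulVec x i) ^ 2 = ∑ i, x i ^ 2 := by
  have : e.mulVec x ⬝ᵥ e.mulVec x = x ⬝ᵥ x := by
    rw [Matrix.dotProduct_mulVec, ← Matrix.mulVec_transpose, Matrix.mulVec_mulVec, he,
      Matrix.one_mulVec]
  simpa [dotProduct, sq] using this

theorem sum_quadratic_eq {n : ℕ} (e : Matrix (Fin n) (Fin n) ℝ) (l x : Fin n → ℝ) :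
    ∑ i, ∑ j, x i * (e.transpose * Matrix.diagonal l * e) i j * x j
      = ∑ i, l i * (e.mulVec x i) ^ 2 := by
  have h1 : ∑ i, ∑ j, x i * (e.transpose * Matrix.diagonal l * e) i j * x j
      = x ⬝ᵥ (e.transpose * Matrix.diagonal l * e).mulVec x := by
    simp [dotProduct, Matrix.mulVec, Finset.mul_sum, mul_assoc]
  rw [h1, ← Matrix.mulVec_mulVec, ← Matrix.mulVec_mulVec, Matrix.dotProduct_mulVec,
    Matrix.vecMul_transpose]
  simp only [dotProduct, Matrix.mulVec_diagonal]
  exact Finset.sum_congr rfl fun i _ => by ring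

theorem sum_entries_sq_eq {n : ℕ} {e : Matrix (Fin n) (Fin n) ℝ} (he : e * e.transpose = 1)
    (l : Fin n → ℝ) :
    ∑ i, ∑ j, ((e.transpose * Matrix.diagonal l * e) i j) ^ 2 = ∑ i, l i ^ 2 := by
  set J := e.transpose * Matrix.diagonal l * e with hJ
  have h1 : ∑ i, ∑ j, (J i j) ^ 2 = (J * J.transpose).trace := by
    simp [Matrix.trace, Matrix.mul_apply, sq]
  have h2 : J * J.transpose
      = e.transpose * (Matrix.diagonal l * (e * e.transpose) * Matrix.diagonal l * e) := by
    simp only [hJ, Matrix.transpose_mul, Matrix.transpose_transpose, Matrix.diagonal_transpose,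
      Matrix.mul_assoc]
  rw [h1, h2, he, Matrix.trace_mul_comm, Matrix.mul_assoc, he]
  simp [Matrix.trace, sq]

theorem sum_Icc_half_pow_natAbs_le (m : ℕ) :
    ∑ k ∈ Finset.Icc (-(m : ℤ)) m, (1 / 2 : ℝ) ^ k.natAbs ≤ 3 - 2 * (1 / 2) ^ m := by
  induction m with
  | zero => norm_num
  | succ m ih =>
    have : Finset.Icc (-((m + 1 : ℕ) : ℤ)) ((m + 1 : ℕ) : ℤ)
        = insert ((m : ℤ) + 1) (insert (-((m : ℤ) + 1)) (Finset.Icc (-(m : ℤ)) m)) := by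
      ext k
      simp only [Finset.mem_Icc, Finset.mem_insert]
      omega
    rw [this, Finset.sum_insert, Finset.sum_insert]
    · have h1 : ((m : ℤ) + 1).natAbs = m + 1 := by omega
      have h2 : (-((m : ℤ) + 1)).natAbs = m + 1 := by omega
      rw [h1, h2, pow_succ]
      linarith
    · simp only [Finset.mem_Icc]; omega
    · simp only [Finset.mem_Icc, Finset.mem_insert]; omega

/-- Counting lattice points supported on `L` in the Euclidean ball of radius `√n`. -/
theorem card_lattice_points_le {n : ℕ} (L : Finset (Fin n)) (K : Finset (Fin n → ℤ))
    (hsupp : ∀ k ∈ K, ∀ i ∉ L, k i = 0) (hnorm : ∀ k ∈ K, ∑ i, ((k i : ℝ)) ^ 2 ≤ n) :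
    (K.card : ℝ) ≤ Real.exp (3 * √(L.card * n)) := by
  set R := √((L.card : ℝ) * n) with hR
  have hLR : (L.card : ℝ) ≤ R := by
    have : (L.card : ℝ) ≤ n := by exact_mod_cast (Finset.card_le_univ L).trans (by simp)
    refine Real.le_sqrt_of_sq_le ?_
    nlinarith [Nat.cast_nonneg (α := ℝ) L.card]
  have hl1 : ∀ k ∈ K, ∑ i, ((k i).natAbs : ℝ) ≤ R := by
    intro k hk
    have h1 : ∑ i, ((k i).natAbs : ℝ) = ∑ i ∈ L, ((k i).natAbs : ℝ) :=
      (Finset.sum_subset (Finset.subset_univ L) fun i _ hi => by simp [hsupp k hk i hi]).symm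
    have h2 : ∑ i ∈ L, ((k i).natAbs : ℝ) ^ 2 ≤ n := by
      refine le_trans ?_ (hnorm k hk)
      simp only [Nat.cast_natAbs, Int.cast_abs, sq_abs]
      exact Finset.sum_le_univ_sum_of_nonneg fun i => sq_nonneg _
    rw [h1]
    refine Real.le_sqrt_of_sq_le (sq_sum_le_card_mul_sum_sq.trans ?_)
    gcongr
  have hmem : ∀ k ∈ K, ∀ i, (k i).natAbs ≤ n := by
    intro k hk i
    have h1 : ((k i : ℝ)) ^ 2 ≤ n :=
      (Finset.single_le_sum (f := fun i => (k i : ℝ) ^ 2) (fun i _ => sq_nonneg _)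
        (Finset.mem_univ i)).trans (hnorm k hk)
    have h2 : (k i).natAbs ^ 2 ≤ n := by
      have : (((k i).natAbs ^ 2 : ℕ) : ℝ) ≤ n := by
        push_cast; simpa [Nat.cast_natAbs, Int.cast_abs, sq_abs] using h1
      exact_mod_cast this
    nlinarith
  set t : Fin n → Finset ℤ := fun i => if i ∈ L then Finset.Icc (-(n : ℤ)) n else {0} with ht
  have hsub : K ⊆ Fintype.piFinset t := by
    intro k hk
    rw [Fintype.mem_piFinset]
    intro i
    by_cases hi : i ∈ L
    · have := hmem k hk i
      simp only [ht, hi, if_true, Finset.mem_Icc]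
      omega
    · simp [ht, hi, hsupp k hk i hi]
  have hexp : ∀ k ∈ K, Real.exp (-R) ≤ ∏ i, (1 / 2 : ℝ) ^ (k i).natAbs := by
    intro k hk
    have h1 : ∏ i, (1 / 2 : ℝ) ^ (k i).natAbs ≥ ∏ i, Real.exp (-((k i).natAbs : ℝ)) := by
      refine Finset.prod_le_prod (fun i _ => (Real.exp_pos _).le) fun i _ => ?_
      have : Real.exp (-((k i).natAbs : ℝ)) = Real.exp (-1) ^ (k i).natAbs := by
        rw [← Real.exp_nat_mul]; ring_nf
      rw [this]
      refine pow_le_pow_left₀ (Real.exp_pos _).le ?_ _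
      rw [Real.exp_neg, one_div]
      exact inv_anti₀ two_pos (by linarith [Real.add_one_le_exp (1 : ℝ)])
    refine le_trans ?_ h1
    rw [← Real.exp_sum, Finset.sum_neg_distrib]
    exact Real.exp_le_exp.2 (neg_le_neg (hl1 k hk))
  have h3 : (3 : ℝ) ≤ Real.exp 2 := by linarith [Real.add_one_le_exp (2 : ℝ)]
  have hsum : (K.card : ℝ) * Real.exp (-R) ≤ Real.exp (2 * L.card) := by
    calc (K.card : ℝ) * Real.exp (-R) = ∑ k ∈ K, Real.exp (-R) := by simp
      _ ≤ ∑ k ∈ K, ∏ i, (1 / 2 : ℝ) ^ (k i).natAbs := Finset.sum_le_sum hexp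
      _ ≤ ∑ k ∈ Fintype.piFinset t, ∏ i, (1 / 2 : ℝ) ^ (k i).natAbs :=
          Finset.sum_le_sum_of_subset_of_nonneg hsub fun _ _ _ => by positivity
      _ = ∏ i, ∑ k ∈ t i, (1 / 2 : ℝ) ^ k.natAbs :=
          (Finset.prod_univ_sum t fun _ k => (1 / 2 : ℝ) ^ k.natAbs).symm
      _ ≤ ∏ i, (if i ∈ L then Real.exp 2 else 1) := by
          refine Finset.prod_le_prod
            (fun i _ => Finset.sum_nonneg fun _ _ => by positivity) fun i _ => ?_
          by_cases hi : i ∈ L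
          · simp only [ht, hi, if_true]
            have : (0 : ℝ) < (1 / 2) ^ n := by positivity
            linarith [sum_Icc_half_pow_natAbs_le n]
          · simp [ht, hi]
      _ = Real.exp (2 * L.card) := by
          rw [Finset.prod_ite_mem, Finset.univ_inter, Finset.prod_const, ← Real.exp_nat_mul]
          ring_nf
  calc (K.card : ℝ) = K.card * Real.exp (-R) * Real.exp R := by
        rw [mul_assoc, ← Real.exp_add]; simp
    _ ≤ Real.exp (2 * L.card) * Real.exp R := by gcongr
    _ = Real.exp (2 * L.card + R) := (Real.exp_add _ _).symm
    _ ≤ Real.exp (3 * R) := Real.exp_le_exp.2 (by linarith)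

/-- A change-of-measure form of the Gibbs variational principle on a finite set. -/
theorem log_sum_exp_le {ι : Type*} {s : Finset ι} (hs : s.Nonempty) (g φ q : ι → ℝ)
    (hq : ∀ x ∈ s, 0 < q x) :
    Real.log (∑ x ∈ s, Real.exp (g x)) ≤ Real.log (∑ x ∈ s, q x * Real.exp (φ x))
      + ∑ x ∈ s, Real.exp (g x) / (∑ z ∈ s, Real.exp (g z)) * (g x - φ x - Real.log (q x)) := by
  set W := ∑ x ∈ s, Real.exp (g x) with hW
  set T := ∑ x ∈ s, q x * Real.exp (φ x) with hT
  have hW0 : 0 < W := Finset.sum_pos (fun x _ => Real.exp_pos _) hs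
  have hT0 : 0 < T := Finset.sum_pos (fun x hx => mul_pos (hq x hx) (Real.exp_pos _)) hs
  have h1 : ∑ x ∈ s, Real.exp (g x) / W = 1 := by
    rw [← Finset.sum_div, div_self hW0.ne']
  have h2 : ∑ x ∈ s, q x * Real.exp (φ x) / T = 1 := by
    rw [← Finset.sum_div, div_self hT0.ne']
  have h3 : ∑ x ∈ s, Real.exp (g x) / W
      * (Real.log (q x) + φ x - g x + (Real.log W - Real.log T) + 1) ≤ 1 := by
    refine (Finset.sum_le_sum fun x hx => ?_).trans h2.le
    calc _ ≤ Real.exp (g x) / W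
          * Real.exp (Real.log (q x) + φ x - g x + (Real.log W - Real.log T)) :=
          mul_le_mul_of_nonneg_left (Real.add_one_le_exp _) (by positivity)
      _ = q x * Real.exp (φ x) / T := by
          rw [Real.exp_add, Real.exp_sub, Real.exp_sub, Real.exp_add, Real.exp_log hW0,
            Real.exp_log hT0, Real.exp_log (hq x hx)]
          field_simp
  have h4 : ∑ x ∈ s, Real.exp (g x) / W
      * (Real.log (q x) + φ x - g x + (Real.log W - Real.log T) + 1)
      = (Real.log W - Real.log T + 1) * ∑ x ∈ s, Real.exp (g x) / W
        - ∑ x ∈ s, Real.exp (g x) / W * (g x - φ x - Real.log (q x)) := by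
    rw [Finset.mul_sum, ← Finset.sum_sub_distrib]
    exact Finset.sum_congr rfl fun x _ => by ring
  rw [h4, h1] at h3
  linarith

theorem log_one_add_mul_div_two {a x : ℝ} (hx : x = -1 ∨ x = 1) (h : 0 < 1 + a * x) :
    Real.log ((1 + a * x) / 2)
      = (1 + x) / 2 * Real.log (1 + a) + (1 - x) / 2 * Real.log (1 - a) - Real.log 2 := by
  rw [Real.log_div h.ne' two_ne_zero]
  rcases hx with rfl | rfl
  · rw [show 1 + a * -1 = 1 - a by ring]; ring
  · rw [show 1 + a * 1 = 1 + a by ring]; ring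

/-- The mean-field bound for quadratic forms all of whose eigenvalues are at most `1 / 16`. -/
theorem exists_meanField_of_eigenvalues_le {n : ℕ} {e : Matrix (Fin n) (Fin n) ℝ}
    (he : e * e.transpose = 1) (v b : Fin n → ℝ) (hb : ∀ i, b i ≤ 1 / 16) :
    ∃ y ∈ solidCube n,
      Real.log (2⁻¹ ^ n * ∑ x ∈ cubeVertices n,
          Real.exp (∑ i, v i * x i + ∑ i, b i * e.mulVec x i ^ 2))
        ≤ ∑ i, v i * y i + ∑ i, b i * e.mulVec y i ^ 2 - cubeEnt n y
          + 8 * ∑ i, max (b i) 0 := by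
  set V := cubeVertices n with hV
  have hne : V.Nonempty := ⟨fun _ => 1, by simp [hV, mem_cubeVertices]⟩
  set g : (Fin n → ℝ) → ℝ := fun x => ∑ i, v i * x i + ∑ i, b i * e.mulVec x i ^ 2 with hg
  set W := ∑ x ∈ V, Real.exp (g x) with hW
  have hW0 : 0 < W := Finset.sum_pos (fun x _ => Real.exp_pos _) hne
  set p : (Fin n → ℝ) → ℝ := fun x => Real.exp (g x) / W with hp
  have hp0 : ∀ x, 0 < p x := fun x => div_pos (Real.exp_pos _) hW0
  have hp1 : ∑ x ∈ V, p x = 1 := by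
    simp only [hp]
    rw [← Finset.sum_div, div_self hW0.ne']
  set a : Fin n → ℝ := fun i => ∑ x ∈ V, p x * x i with ha
  have hpos : ∀ x ∈ V, ∀ i, 0 < 1 + a i * x i := by
    intro x hx i
    have h1 : 1 + a i * x i = ∑ z ∈ V, p z * (1 + z i * x i) := by
      simp only [mul_add, mul_one, Finset.sum_add_distrib, hp1, ha, Finset.sum_mul, mul_assoc]
    rw [h1]
    refine Finset.sum_pos' (fun z hz => mul_nonneg (hp0 z).le ?_) ⟨x, hx, mul_pos (hp0 x) ?_⟩
    · rcases mem_cubeVertices.1 hz i with h | h <;>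
        rcases mem_cubeVertices.1 hx i with h' | h' <;> rw [h, h'] <;> norm_num
    · rcases mem_cubeVertices.1 hx i with h | h <;> rw [h] <;> norm_num
  have hab : ∀ i, |a i| ≤ 1 := by
    intro i
    have h1 := hpos (fun _ => 1) (by simp [hV, mem_cubeVertices]) i
    have h2 := hpos (fun _ => -1) (by simp [hV, mem_cubeVertices]) i
    exact abs_le.2 ⟨by linarith, by linarith⟩
  refine ⟨a, fun i => abs_le.1 (hab i), ?_⟩
  set φ : (Fin n → ℝ) → ℝ := fun x => ∑ i, b i * e.mulVec (x - a) i ^ 2 with hφ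
  have hq0 : ∀ x ∈ V, 0 < cubeProd a x := fun x hx =>
    Finset.prod_pos fun i _ => div_pos (hpos x hx i) two_pos
  have hgibbs := log_sum_exp_le hne g φ (cubeProd a) hq0
  have hT0 : 0 < ∑ x ∈ V, cubeProd a x * Real.exp (φ x) :=
    Finset.sum_pos (fun x hx => mul_pos (hq0 x hx) (Real.exp_pos _)) hne
  have hT : Real.log (∑ x ∈ V, cubeProd a x * Real.exp (φ x)) ≤ 8 * ∑ i, max (b i) 0 := by
    rw [Real.log_le_iff_le_exp hT0]
    refine le_trans (Finset.sum_le_sum fun x hx => ?_)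
      (sum_mul_exp_quadratic_le V (cubeProd a) (fun x => e.mulVec (x - a)) ?_
        (fun i => max (b i) 0) (fun i => le_max_right _ _)
        fun i => max_le (hb i) (by norm_num))
    · refine mul_le_mul_of_nonneg_left (Real.exp_le_exp.2 ?_) (hq0 x hx).le
      exact Finset.sum_le_sum fun i _ =>
        mul_le_mul_of_nonneg_right (le_max_left _ _) (sq_nonneg _)
    · intro t
      have h1 : ∀ x : Fin n → ℝ, ∑ i, t i * e.mulVec (x - a) i
          = ∑ i, e.transpose.mulVec t i * (x i - a i) := by
        intro x
        change t ⬝ᵥ e.mulVec (x - a) = e.transpose.mulVec t ⬝ᵥ (x - a)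
        rw [Matrix.dotProduct_mulVec, Matrix.mulVec_transpose]
      simp_rw [h1]
      refine (sum_cubeProd_mul_exp_le hab _).trans (le_of_eq ?_)
      rw [sum_mulVec_sq (by rwa [Matrix.transpose_transpose])]
  have hlin : ∀ c : Fin n → ℝ, ∑ x ∈ V, p x * ∑ i, c i * x i = ∑ i, c i * a i := by
    intro c
    simp only [ha, Finset.mul_sum]
    rw [Finset.sum_comm]
    exact Finset.sum_congr rfl fun i _ => Finset.sum_congr rfl fun x _ => by ring
  have hmul : ∀ i, ∑ x ∈ V, p x * e.mulVec x i = e.mulVec a i := fun i => hlin (e i)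
  have hdiff : ∑ x ∈ V, p x * (g x - φ x) = ∑ i, v i * a i + ∑ i, b i * e.mulVec a i ^ 2 := by
    have h1 : ∀ x, p x * (g x - φ x) = p x * ∑ i, v i * x i
        + ∑ i, (2 * b i * e.mulVec a i * (p x * e.mulVec x i)
          - b i * e.mulVec a i ^ 2 * p x) := by
      intro x
      simp only [hg, hφ]
      rw [add_sub_assoc, ← Finset.sum_sub_distrib, mul_add,
        Finset.mul_sum Finset.univ (fun i => _ - _)]
      congr 1
      refine Finset.sum_congr rfl fun i _ => ?_
      rw [Matrix.mulVec_sub, Pi.sub_apply]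
      ring
    simp_rw [h1]
    rw [Finset.sum_add_distrib, hlin, Finset.sum_comm]
    congr 1
    refine Finset.sum_congr rfl fun i _ => ?_
    rw [Finset.sum_sub_distrib, ← Finset.mul_sum, ← Finset.mul_sum, hmul, hp1]
    ring
  have hent : ∑ x ∈ V, p x * Real.log (cubeProd a x) = cubeEnt n a - n * Real.log 2 := by
    have h1 : ∀ x ∈ V, p x * Real.log (cubeProd a x)
        = ∑ i, ((p x + p x * x i) / 2 * Real.log (1 + a i)
          + (p x - p x * x i) / 2 * Real.log (1 - a i) - p x * Real.log 2) := by
      intro x hx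
      rw [cubeProd, Real.log_prod fun i _ => (div_pos (hpos x hx i) two_pos).ne', Finset.mul_sum]
      refine Finset.sum_congr rfl fun i _ => ?_
      rw [log_one_add_mul_div_two (mem_cubeVertices.1 hx i) (hpos x hx i)]
      ring
    rw [Finset.sum_congr rfl h1, Finset.sum_comm, cubeEnt]
    have h2 : (n : ℝ) * Real.log 2 = ∑ _i : Fin n, Real.log 2 := by simp
    rw [h2, ← Finset.sum_sub_distrib]
    refine Finset.sum_congr rfl fun i _ => ?_
    rw [Finset.sum_sub_distrib, Finset.sum_add_distrib, ← Finset.sum_mul, ← Finset.sum_mul,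
      ← Finset.sum_mul, ← Finset.sum_div, ← Finset.sum_div, Finset.sum_add_distrib,
      Finset.sum_sub_distrib, hp1]
    ring
  have hsplit : ∑ x ∈ V, p x * (g x - φ x - Real.log (cubeProd a x))
      = ∑ x ∈ V, p x * (g x - φ x) - ∑ x ∈ V, p x * Real.log (cubeProd a x) := by
    rw [← Finset.sum_sub_distrib]
    exact Finset.sum_congr rfl fun x _ => by ring
  change Real.log W ≤ _ + ∑ x ∈ V, p x * (g x - φ x - Real.log (cubeProd a x)) at hgibbs
  rw [hsplit, hdiff, hent] at hgibbs
  change Real.log (2⁻¹ ^ n * W) ≤ _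
  rw [Real.log_mul (by positivity) hW0.ne', Real.log_pow, Real.log_inv]
  linarith

theorem bddAbove_meanField (n : ℕ) (J : Matrix (Fin n) (Fin n) ℝ) (h : Fin n → ℝ) :
    BddAbove (Set.range fun y : solidCube n =>
      (∑ i, ∑ j, (y : Fin n → ℝ) i * J i j * (y : Fin n → ℝ) j)
        + (∑ i, h i * (y : Fin n → ℝ) i) - cubeEnt n y) := by
  have hc : IsCompact (solidCube n) := by
    have : solidCube n = Set.univ.pi fun _ => Set.Icc (-1 : ℝ) 1 := by
      ext y; simp only [solidCube, Set.mem_ofPred_eq, Set.mem_univ_pi]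
    rw [this]
    exact isCompact_univ_pi fun _ => isCompact_Icc
  have hcont : Continuous fun y : Fin n → ℝ =>
      (∑ i, ∑ j, y i * J i j * y j) + (∑ i, h i * y i) - cubeEnt n y := by
    have h1 : Continuous fun y : Fin n → ℝ => cubeEnt n y := by
      unfold cubeEnt
      simp_rw [div_mul_eq_mul_div]
      refine continuous_finsetSum _ fun i _ => ?_
      have e1 : Continuous fun y : Fin n → ℝ => (1 + y i) * Real.log (1 + y i) :=
        Real.continuous_mul_log.comp (by fun_prop)
      have e2 : Continuous fun y : Fin n → ℝ => (1 - y i) * Real.log (1 - y i) :=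
        Real.continuous_mul_log.comp (by fun_prop)
      exact (e1.div_const 2).add (e2.div_const 2)
    exact Continuous.sub (by fun_prop) h1
  have := hc.bddAbove_image hcont.continuousOn
  rwa [Set.image_eq_range] at this

theorem exists_int_near (u : ℝ) : ∃ k : ℤ, (k : ℝ) ^ 2 ≤ u ^ 2 ∧ (u - k) ^ 2 ≤ 1 := by
  rcases le_total 0 u with hu | hu
  · refine ⟨⌊u⌋, ?_, ?_⟩
    · have : (0 : ℝ) ≤ ⌊u⌋ := by exact_mod_cast Int.floor_nonneg.2 hu
      nlinarith [Int.floor_le u]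
    · nlinarith [Int.floor_le u, Int.lt_floor_add_one u]
  · refine ⟨⌈u⌉, ?_, ?_⟩
    · have : (⌈u⌉ : ℝ) ≤ 0 := by exact_mod_cast Int.ceil_nonpos.2 hu
      nlinarith [Int.le_ceil u]
    · nlinarith [Int.le_ceil u, Int.ceil_lt_add_one u]

/-- Mean-field bound in diagonal coordinates: the eigendirections in `L` are discretized, the
others are treated by `exists_meanField_of_eigenvalues_le`. -/
theorem log_sum_exp_le_of_diagonal {n : ℕ} {e : Matrix (Fin n) (Fin n) ℝ}
    (he : e * e.transpose = 1) (he' : e.transpose * e = 1) (l h : Fin n → ℝ)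
    (L : Finset (Fin n)) (hL0 : ∀ i ∈ L, 0 ≤ l i) (hL : ∀ i ∉ L, l i ≤ 1 / 16) {M : ℝ}
    (hM : ∀ y ∈ solidCube n,
      ∑ i, l i * e.mulVec y i ^ 2 + ∑ i, h i * y i - cubeEnt n y ≤ M) :
    Real.log (2⁻¹ ^ n * ∑ x ∈ cubeVertices n,
        Real.exp (∑ i, l i * e.mulVec x i ^ 2 + ∑ i, h i * x i))
      ≤ M + 9 * ∑ i, |l i| + 3 * √(L.card * n) := by
  set V := cubeVertices n with hV
  have hne : V.Nonempty := ⟨fun _ => 1, by simp [hV, mem_cubeVertices]⟩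
  choose r hr1 hr2 using exists_int_near
  set k : (Fin n → ℝ) → Fin n → ℤ := fun x i => if i ∈ L then r (e.mulVec x i) else 0 with hk
  set K := V.image k with hK
  have hcard : (K.card : ℝ) ≤ Real.exp (3 * √(L.card * n)) := by
    refine card_lattice_points_le L K ?_ ?_
    · intro κ hκ i hi
      obtain ⟨x, -, rfl⟩ := Finset.mem_image.1 hκ
      simp [hk, hi]
    · intro κ hκ
      obtain ⟨x, hx, rfl⟩ := Finset.mem_image.1 hκ
      have h1 : ∑ i, x i ^ 2 = n := by
        rw [Finset.sum_congr rfl fun i _ => show x i ^ 2 = 1 by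
          rcases mem_cubeVertices.1 hx i with h | h <;> rw [h] <;> norm_num]
        simp
      rw [← h1, ← sum_mulVec_sq he' x]
      refine Finset.sum_le_sum fun i _ => ?_
      by_cases hi : i ∈ L
      · simpa [hk, hi] using hr1 (e.mulVec x i)
      · simpa [hk, hi] using sq_nonneg (e.mulVec x i)
  set b : Fin n → ℝ := fun i => if i ∈ L then 0 else l i with hb
  set c : (Fin n → ℤ) → Fin n → ℝ := fun κ i => if i ∈ L then l i * κ i else 0 with hc
  set v : (Fin n → ℤ) → Fin n → ℝ := fun κ => h + e.transpose.mulVec (2 • c κ) with hv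
  set d : (Fin n → ℤ) → ℝ := fun κ => ∑ i, c κ i * κ i with hd
  set G : (Fin n → ℤ) → (Fin n → ℝ) → ℝ := fun κ x =>
    ∑ i, v κ i * x i + ∑ i, b i * e.mulVec x i ^ 2 with hG
  have hvx : ∀ κ (x : Fin n → ℝ),
      ∑ i, v κ i * x i = ∑ i, h i * x i + ∑ i, 2 * c κ i * e.mulVec x i := by
    intro κ x
    have h1 : e.transpose.mulVec (2 • c κ) ⬝ᵥ x = (2 • c κ) ⬝ᵥ e.mulVec x := by
      rw [Matrix.dotProduct_mulVec, Matrix.mulVec_transpose]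
    simp only [dotProduct] at h1
    simp only [hv, Pi.add_apply, add_mul, Finset.sum_add_distrib, h1]
    simp
  have hGx : ∀ κ (x : Fin n → ℝ), G κ x - d κ
      = ∑ i, h i * x i + ∑ i, (2 * c κ i * e.mulVec x i + b i * e.mulVec x i ^ 2
        - c κ i * κ i) := by
    intro κ x
    simp only [hG, hd, hvx, Finset.sum_add_distrib, Finset.sum_sub_distrib]
    ring
  have hupper : ∀ κ (x : Fin n → ℝ),
      G κ x - d κ ≤ ∑ i, l i * e.mulVec x i ^ 2 + ∑ i, h i * x i := by
    intro κ x
    rw [hGx, add_comm]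
    gcongr with i _
    by_cases hi : i ∈ L
    · simp only [hc, hb, hi, if_true]
      nlinarith [mul_nonneg (hL0 i hi) (sq_nonneg (e.mulVec x i - κ i))]
    · simp [hc, hb, hi]
  have hlower : ∀ x : Fin n → ℝ, ∑ i, l i * e.mulVec x i ^ 2 + ∑ i, h i * x i
      ≤ G (k x) x - d (k x) + ∑ i ∈ L, l i := by
    intro x
    have h1 : ∑ i ∈ L, l i = ∑ i, if i ∈ L then l i else 0 := by simp
    rw [hGx, h1, add_assoc, add_comm]
    refine add_le_add le_rfl ?_
    rw [← Finset.sum_add_distrib]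
    refine Finset.sum_le_sum fun i _ => ?_
    by_cases hi : i ∈ L
    · simp only [hc, hb, hk, hi, if_true]
      nlinarith [mul_le_mul_of_nonneg_left (hr2 (e.mulVec x i)) (hL0 i hi)]
    · simp [hc, hb, hi]
  have hbl : ∑ i ∈ L, l i + 8 * ∑ i, max (b i) 0 ≤ 9 * ∑ i, |l i| := by
    have h1 : ∑ i ∈ L, l i ≤ ∑ i, |l i| :=
      (Finset.sum_le_sum fun i _ => le_abs_self _).trans
        (Finset.sum_le_univ_sum_of_nonneg fun i => abs_nonneg _)
    have h2 : ∑ i, max (b i) 0 ≤ ∑ i, |l i| := by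
      refine Finset.sum_le_sum fun i _ => max_le ?_ (abs_nonneg _)
      by_cases hi : i ∈ L
      · simp [hb, hi]
      · simpa [hb, hi] using le_abs_self (l i)
    linarith
  have hZ : ∀ κ, 2⁻¹ ^ n * ∑ x ∈ V, Real.exp (G κ x - d κ + ∑ i ∈ L, l i)
      ≤ Real.exp (M + 9 * ∑ i, |l i|) := by
    intro κ
    obtain ⟨y, hy, hle⟩ := exists_meanField_of_eigenvalues_le he (v κ) b (fun i => by
      by_cases hi : i ∈ L
      · simp [hb, hi]
      · simpa [hb, hi] using hL i hi)
    have hpos : 0 < 2⁻¹ ^ n * ∑ x ∈ V, Real.exp (G κ x) :=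
      mul_pos (by positivity) (Finset.sum_pos (fun x _ => Real.exp_pos _) hne)
    have h1 := (Real.log_le_iff_le_exp hpos).1 hle
    have h2 := hupper κ y
    have h3 := hM y hy
    calc 2⁻¹ ^ n * ∑ x ∈ V, Real.exp (G κ x - d κ + ∑ i ∈ L, l i)
        = 2⁻¹ ^ n * (∑ x ∈ V, Real.exp (G κ x)) * Real.exp (∑ i ∈ L, l i - d κ) := by
          rw [mul_assoc, Finset.sum_mul]
          simp_rw [← Real.exp_add, sub_add_eq_add_sub, add_sub_assoc]
      _ ≤ Real.exp (∑ i, v κ i * y i + ∑ i, b i * e.mulVec y i ^ 2 - cubeEnt n y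
            + 8 * ∑ i, max (b i) 0) * Real.exp (∑ i ∈ L, l i - d κ) := by gcongr
      _ ≤ Real.exp (M + 9 * ∑ i, |l i|) := by
          rw [← Real.exp_add]
          refine Real.exp_le_exp.2 ?_
          simp only [hG] at h2
          linarith
  have hpos : 0 < 2⁻¹ ^ n * ∑ x ∈ V,
      Real.exp (∑ i, l i * e.mulVec x i ^ 2 + ∑ i, h i * x i) :=
    mul_pos (by positivity) (Finset.sum_pos (fun x _ => Real.exp_pos _) hne)
  rw [Real.log_le_iff_le_exp hpos]
  calc 2⁻¹ ^ n * ∑ x ∈ V, Real.exp (∑ i, l i * e.mulVec x i ^ 2 + ∑ i, h i * x i)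
      ≤ 2⁻¹ ^ n * ∑ x ∈ V, ∑ κ ∈ K, Real.exp (G κ x - d κ + ∑ i ∈ L, l i) := by
        gcongr with x hx
        exact (Real.exp_le_exp.2 (hlower x)).trans
          (Finset.single_le_sum
            (f := fun κ => Real.exp (G κ x - d κ + ∑ i ∈ L, l i))
            (fun κ _ => (Real.exp_pos _).le) (Finset.mem_image_of_mem k hx))
    _ = ∑ κ ∈ K, 2⁻¹ ^ n * ∑ x ∈ V, Real.exp (G κ x - d κ + ∑ i ∈ L, l i) := by
        rw [Finset.sum_comm, Finset.mul_sum]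
    _ ≤ ∑ κ ∈ K, Real.exp (M + 9 * ∑ i, |l i|) := Finset.sum_le_sum fun κ _ => hZ κ
    _ = K.card * Real.exp (M + 9 * ∑ i, |l i|) := by simp
    _ ≤ Real.exp (3 * √(L.card * n)) * Real.exp (M + 9 * ∑ i, |l i|) := by gcongr
    _ = Real.exp (M + 9 * ∑ i, |l i| + 3 * √(L.card * n)) := by
        rw [← Real.exp_add, add_comm]

/-- **Mean-field approximation for the Ising model.** There is a universal constant
`κ > 0` such that for every symmetric interaction matrix `J` with zero diagonal and every
external field `h`,
`log ∫ exp (⟨x,Jx⟩ + ⟨h,x⟩) dμ ≤ sup_{y ∈ [-1,1]ⁿ} (⟨y,Jy⟩ + ⟨h,y⟩ - I(y)) + κ ‖J‖₂ √n`. -/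
theorem ising_meanField :
    ∃ κ : ℝ, 0 < κ ∧ ∀ (n : ℕ) (J : Matrix (Fin n) (Fin n) ℝ) (h : Fin n → ℝ),
      J.IsSymm → (∀ i, J i i = 0) →
      Real.log (∫ x, Real.exp ((∑ i, ∑ j, x i * J i j * x j) + ∑ i, h i * x i)
          ∂cubeUniform n) ≤
        (⨆ y : solidCube n,
            ((∑ i, ∑ j, (y : Fin n → ℝ) i * J i j * (y : Fin n → ℝ) j)
              + (∑ i, h i * (y : Fin n → ℝ) i) - cubeEnt n y)) +
          κ * Real.sqrt (∑ i, ∑ j, (J i j) ^ 2) * Real.sqrt n := by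
  refine ⟨57, by norm_num, fun n J h hJ _ => ?_⟩
  have hbdd := bddAbove_meanField n J h
  obtain ⟨e, l, he, he', rfl⟩ := exists_orthogonal_diagonalization hJ
  set L : Finset (Fin n) := Finset.univ.filter fun i => 1 / 16 < l i with hL
  have hmem : ∀ i, i ∈ L ↔ 1 / 16 < l i := fun i => by simp [hL]
  have hmain := log_sum_exp_le_of_diagonal he he' l h L
    (fun i hi => by linarith [(hmem i).1 hi]) (fun i hi => not_lt.1 fun hlt => hi ((hmem i).2 hlt))
    (fun y hy => by simpa only [sum_quadratic_eq] using le_ciSup hbdd ⟨y, hy⟩)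
  rw [integral_cubeUniform, sum_entries_sq_eq he]
  simp only [sum_quadratic_eq] at hmain ⊢
  have h1 : ∑ i, |l i| ≤ √(∑ i, l i ^ 2) * √n := by
    rw [← Real.sqrt_mul (Finset.sum_nonneg fun i _ => sq_nonneg _)]
    refine Real.le_sqrt_of_sq_le (sq_sum_le_card_mul_sum_sq.trans (le_of_eq ?_))
    simp [mul_comm]
  have h2 : √(L.card * n) ≤ 16 * √(∑ i, l i ^ 2) * √n := by
    rw [Real.sqrt_mul (Nat.cast_nonneg _)]
    refine mul_le_mul_of_nonneg_right ?_ (Real.sqrt_nonneg _)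
    have h3 : (L.card : ℝ) * (1 / 16) ^ 2 ≤ ∑ i, l i ^ 2 := by
      calc (L.card : ℝ) * (1 / 16) ^ 2 = ∑ i ∈ L, (1 / 16 : ℝ) ^ 2 := by simp
        _ ≤ ∑ i ∈ L, l i ^ 2 := Finset.sum_le_sum fun i hi =>
            pow_le_pow_left₀ (by norm_num) ((hmem i).1 hi).le 2
        _ ≤ ∑ i, l i ^ 2 := Finset.sum_le_univ_sum_of_nonneg fun i => sq_nonneg _
    rw [Real.sqrt_le_left (by positivity), mul_pow,
      Real.sq_sqrt (Finset.sum_nonneg fun i _ => sq_nonneg _)]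
    linarith
  linarith
end
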